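/- arXiv:1201.0557 — 3 statements merged into one kernel-verified Lean document; each statement's English description precedes it below -/
import Mathlib

section
/- Let A be a finite idempotent algebra possessing a Taylor term and having no proper absorbing subalgebra. Then there exists a term operation v of A such that for any elements b, c ∈ A and any coordinate i < arity(v), there exist a_0,...,a_{arity(v)-1} ∈ A with a_i = b and v(a_0,...,a_{arity(v)-1}) = c. -/
structure Signature : Type 1 where
  symbols : Type
  arity : symbols → ℕ

structure UAlgebra (σ : Signature) : Type 1 where
  carrier : Type
  op : ∀ s : σ.symbols, (Fin (σ.arity s) → carrier) → carrier

inductive Term (σ : Signature) (n : ℕ) : Type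
  | var : Fin n → Term σ n
  | app (s : σ.symbols) : (Fin (σ.arity s) → Term σ n) → Term σ n

def Term.eval {σ : Signature} (A : UAlgebra σ) {n : ℕ} :
    Term σ n → (Fin n → A.carrier) → A.carrier
  | .var i, x => x i
  | .app s ts, x => A.op s fun j => Term.eval A (ts j) x

/-- `B` is a subuniverse of the algebra `A`. -/
def Subuniverse {σ : Signature} (A : UAlgebra σ) (B : Set A.carrier) : Prop :=
  ∀ (s : σ.symbols) (a : Fin (σ.arity s) → A.carrier), (∀ i, a i ∈ B) → A.op s a ∈ B

/-- `B` absorbs `A` with respect to the term `t`. -/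
def AbsorbsWith {σ : Signature} (A : UAlgebra σ) (B : Set A.carrier) {n : ℕ} (t : Term σ n) : Prop :=
  ∀ (k : Fin n) (a : Fin n → A.carrier), (∀ i, i ≠ k → a i ∈ B) → t.eval A a ∈ B

/-- `C` absorbs the subalgebra with universe `B` (inside the ambient algebra `A`)
with respect to the term `t`. -/
def AbsorbsWithIn {σ : Signature} (A : UAlgebra σ) (B C : Set A.carrier) {n : ℕ}
    (t : Term σ n) : Prop :=
  ∀ (k : Fin n) (a : Fin n → A.carrier), (∀ i, a i ∈ B) → (∀ i, i ≠ k → a i ∈ C) →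
    t.eval A a ∈ C

/-- `B` is an absorbing subalgebra (subuniverse) of `A`. -/
def Absorbing {σ : Signature} (A : UAlgebra σ) (B : Set A.carrier) : Prop :=
  Subuniverse A B ∧ ∃ (n : ℕ) (t : Term σ n), AbsorbsWith A B t

/-- `B` is a proper absorbing subalgebra of `A`: `∅ ≠ B ≠ A`. -/
def ProperAbsorbing {σ : Signature} (A : UAlgebra σ) (B : Set A.carrier) : Prop :=
  Absorbing A B ∧ B.Nonempty ∧ B ≠ Set.univ

/-- `C` is a minimal absorbing subalgebra of `A`. -/
def MinAbsorbing {σ : Signature} (A : UAlgebra σ) (C : Set A.carrier) : Prop :=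
  Absorbing A C ∧ C.Nonempty ∧ ∀ C' ⊆ C, Absorbing A C' → C'.Nonempty → C' = C

/-- All (basic, equivalently term) operations of `A` are idempotent. -/
def Idempotent {σ : Signature} (A : UAlgebra σ) : Prop :=
  ∀ (s : σ.symbols) (a : A.carrier), A.op s (fun _ => a) = a

/-- `t` is a Taylor term of the algebra `A`. -/
def IsTaylorTerm {σ : Signature} (A : UAlgebra σ) {k : ℕ} (t : Term σ k) : Prop :=
  (∀ a : A.carrier, t.eval A (fun _ => a) = a) ∧
  ∀ j : Fin k, ∃ u v : Fin k → Fin 2, u j = 0 ∧ v j = 1 ∧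
    ∀ x : Fin 2 → A.carrier, t.eval A (fun i => x (u i)) = t.eval A (fun i => x (v i))

/-- The product of two algebras of the same signature. -/
def UAlgebra.prod {σ : Signature} (A B : UAlgebra σ) : UAlgebra σ where
  carrier := A.carrier × B.carrier
  op s x := (A.op s fun i => (x i).1, B.op s fun i => (x i).2)

/-- The `k`-th power of an algebra. -/
def UAlgebra.pow {σ : Signature} (A : UAlgebra σ) (k : ℕ) : UAlgebra σ where
  carrier := Fin k → A.carrier
  op s x := fun j => A.op s fun i => x i j

/-- `R ⊆ A × B` is subdirect: both projections are onto. -/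
def Subdirect2 {α β : Type} (R : Set (α × β)) : Prop :=
  (∀ a, ∃ b, (a, b) ∈ R) ∧ ∀ b, ∃ a, (a, b) ∈ R

/-- `a` and `a'` are linked in `R` (connected in the bipartite graph of `R`). -/
def LinkedPair {α β : Type} (R : Set (α × β)) (a a' : α) : Prop :=
  Relation.ReflTransGen (fun x y => ∃ b, (x, b) ∈ R ∧ (y, b) ∈ R) a a'

/-- `R` is linked: any two elements of the projection of `R` to the first
coordinate are `R`-linked. -/
def IsLinked {α β : Type} (R : Set (α × β)) : Prop :=
  ∀ a a', (∃ b, (a, b) ∈ R) → (∃ b, (a', b) ∈ R) → LinkedPair R a a'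

/-- Cyclic shift of a `k`-tuple. -/
def cycShift {α : Type} {k : ℕ} (x : Fin k → α) : Fin k → α := fun i =>
  x ⟨(i.val + 1) % k, Nat.mod_lt _ (Nat.lt_of_le_of_lt (Nat.zero_le _) i.isLt)⟩

/-- `t` is a cyclic term of `A`: idempotent and invariant under cyclic shift. -/
def IsCyclicTerm {σ : Signature} (A : UAlgebra σ) {k : ℕ} (t : Term σ k) : Prop :=
  (∀ a : A.carrier, t.eval A (fun _ => a) = a) ∧
  ∀ x : Fin k → A.carrier, t.eval A x = t.eval A (cycShift x)


/-- The term operations of `A` in the variables `ι`. -/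
inductive TermOp {σ : Signature} (A : UAlgebra σ) {ι : Type} :
    ((ι → A.carrier) → A.carrier) → Prop
  | var (i : ι) : TermOp A fun x => x i
  | app (s : σ.symbols) (f : Fin (σ.arity s) → (ι → A.carrier) → A.carrier)
      (hf : ∀ j, TermOp A (f j)) : TermOp A fun x => A.op s fun j => f j x

/-- The universe of the subalgebra of `A` generated by `S`. -/
def generated {σ : Signature} (A : UAlgebra σ) (S : Set A.carrier) : Set A.carrier :=
  {x | ∃ f : (S → A.carrier) → A.carrier, TermOp A f ∧ f Subtype.val = x}

/-- `f` takes the value `c` at some tuple whose entry at coordinate `i` is `b`. -/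
def Attains {ι α : Type} (f : (ι → α) → α) (i : ι) (b c : α) : Prop :=
  ∃ x, x i = b ∧ f x = c

/-- The `n`-th iterate, starting from `{b}`, of the operator that takes the image of a set under
the relation `T` and generates a subalgebra. -/
def reach {σ : Signature} (A : UAlgebra σ) (T : A.carrier → A.carrier → Prop)
    (b : A.carrier) : ℕ → Set A.carrier
  | 0 => {b}
  | n + 1 => generated A {c | ∃ d ∈ reach A T b n, T d c}

section

variable {σ : Signature} {A : UAlgebra σ}

theorem termOp_eval {n : ℕ} (t : Term σ n) : TermOp A (t.eval A) := by
  induction t with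
  | var i => exact .var i
  | app s ts ih => exact .app s _ ih

theorem TermOp.exists_term {n : ℕ} {f : (Fin n → A.carrier) → A.carrier} (hf : TermOp A f) :
    ∃ t : Term σ n, t.eval A = f := by
  induction hf with
  | var i => exact ⟨.var i, rfl⟩
  | app s f _ ih =>
    choose t ht using ih
    refine ⟨.app s t, ?_⟩
    funext x
    simp [Term.eval, ht]

theorem TermOp.comp {ι κ : Type} {f : (ι → A.carrier) → A.carrier} (hf : TermOp A f)
    {g : ι → (κ → A.carrier) → A.carrier} (hg : ∀ i, TermOp A (g i)) :
    TermOp A fun x => f fun i => g i x := by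
  induction hf with
  | var i => exact hg i
  | app s f _ ih => exact .app s _ ih

theorem TermOp.reindex {ι κ : Type} {f : (ι → A.carrier) → A.carrier} (hf : TermOp A f)
    (e : ι → κ) : TermOp A fun x : κ → A.carrier => f fun i => x (e i) :=
  hf.comp fun i => .var (e i)

theorem TermOp.idem (hI : Idempotent A) {ι : Type} {f : (ι → A.carrier) → A.carrier}
    (hf : TermOp A f) (a : A.carrier) : f (fun _ => a) = a := by
  induction hf with
  | var i => rfl
  | app s f _ ih => simp only [ih, hI s a]

theorem Subuniverse.termOp_mem {B : Set A.carrier} (hB : Subuniverse A B) {ι : Type}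
    {f : (ι → A.carrier) → A.carrier} (hf : TermOp A f) {x : ι → A.carrier} (hx : ∀ i, x i ∈ B) :
    f x ∈ B := by
  induction hf with
  | var i => exact hx i
  | app s f _ ih => exact hB s _ ih

theorem subuniverse_generated (S : Set A.carrier) : Subuniverse A (generated A S) := by
  intro s a ha
  choose f hf hfa using ha
  exact ⟨_, .app s f hf, by simp only [hfa]⟩

theorem subset_generated (S : Set A.carrier) : S ⊆ generated A S :=
  fun x hx => ⟨_, .var ⟨x, hx⟩, rfl⟩

theorem generated_mono {S S' : Set A.carrier} (h : S ⊆ S') :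
    generated A S ⊆ generated A S' := by
  rintro x ⟨f, hf, rfl⟩
  exact (subuniverse_generated S').termOp_mem hf fun i => subset_generated S' (h i.2)

/-- A finite idempotent algebra has a single term operation producing every generated
subalgebra from its generators. -/
theorem exists_generating_termOp [Finite A.carrier] (hI : Idempotent A) :
    ∃ (ι : Type) (_ : Finite ι) (f : (ι → A.carrier) → A.carrier), TermOp A f ∧
      ∀ S, ∀ x ∈ generated A S, ∃ a : ι → A.carrier, (∀ i, a i ∈ S) ∧ f a = x := by
  suffices H : ∀ P : Set (Set A.carrier × A.carrier), P.Finite →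
      ∃ (ι : Type) (_ : Finite ι) (f : (ι → A.carrier) → A.carrier), TermOp A f ∧
        ∀ p ∈ P, p.2 ∈ generated A p.1 → ∃ a : ι → A.carrier, (∀ i, a i ∈ p.1) ∧ f a = p.2 by
    obtain ⟨ι, hι, f, hf, h⟩ := H Set.univ Set.finite_univ
    exact ⟨ι, hι, f, hf, fun S x hx => h (S, x) trivial hx⟩
  intro P hP
  induction P, hP using Set.Finite.induction_on with
  | empty => exact ⟨Unit, inferInstance, _, .var (), by simp⟩
  | @insert p P _ _ ih =>
    obtain ⟨ι, hι, f, hf, h⟩ := ih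
    by_cases hp : p.2 ∈ generated A p.1
    · obtain ⟨g, hg, hgp⟩ := hp
      refine ⟨ι × p.1, inferInstance, fun x => f fun i => g fun j => x (i, j),
        hf.comp fun i => hg.reindex (Prod.mk i), ?_⟩
      rintro q (rfl | hq) hqg
      · exact ⟨fun z => z.2, fun z => z.2.2, by simp only [hgp, hf.idem hI]⟩
      · obtain ⟨a, ha, hfa⟩ := h q hq hqg
        exact ⟨fun z => a z.1, fun z => ha z.1, by simp only [hg.idem hI, hfa]⟩
    · refine ⟨ι, hι, f, hf, ?_⟩
      rintro q (rfl | hq) hqg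
      · exact absurd hqg hp
      · exact h q hq hqg

/-- A power of an idempotent term operation with one axis for each element of `ι`: on arguments
depending on one axis only, it acts as the given operation. -/
theorem exists_power_termOp (hI : Idempotent A) (ι : Type) [Finite ι] {L : Type}
    {f : (L → A.carrier) → A.carrier} (hf : TermOp A f) :
    ∃ F : ((ι → L) → A.carrier) → A.carrier, TermOp A F ∧
      ∀ (i : ι) (g : L → A.carrier), F (fun l => g (l i)) = f g := by
  suffices H : ∀ n, ∃ F : ((Fin n → L) → A.carrier) → A.carrier, TermOp A F ∧
      ∀ (i : Fin n) (g : L → A.carrier), F (fun l => g (l i)) = f g by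
    obtain ⟨n, ⟨e⟩⟩ := Finite.exists_equiv_fin ι
    obtain ⟨F, hF, h⟩ := H n
    refine ⟨_, hF.reindex fun l i => l (e i), fun i g => h (e i) g⟩
  intro n
  induction n with
  | zero => exact ⟨_, .var Fin.elim0, fun i => i.elim0⟩
  | succ n ih =>
    obtain ⟨F, hF, h⟩ := ih
    refine ⟨fun x => f fun l => F fun μ => x (Fin.cons l μ),
      hf.comp fun l => hF.reindex fun μ => (Fin.cons l μ : Fin (n + 1) → L), fun i g => ?_⟩
    cases i using Fin.cases with
    | zero => simp only [Fin.cons_zero, hF.idem hI]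
    | succ i => simp only [Fin.cons_succ, h, hf.idem hI]

/-- Any term operation can be expanded to one whose sets of attained values contain the
subalgebras generated by the original ones. -/
theorem exists_saturation [Finite A.carrier] (hI : Idempotent A) {ι : Type} [Finite ι]
    {u : (ι → A.carrier) → A.carrier} (hu : TermOp A u) :
    ∃ (κ : Type) (_ : Finite κ) (π : κ → ι) (w : (κ → A.carrier) → A.carrier), TermOp A w ∧
      ∀ (q : κ) (b : A.carrier), ∀ c ∈ generated A {c | Attains u (π q) b c},
        Attains w q b c := by
  classical
  obtain ⟨L, hL, f, hf, hgen⟩ := exists_generating_termOp hI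
  obtain ⟨F, hF, hpow⟩ := exists_power_termOp hI ι hf
  refine ⟨Σ i : ι, ({j // j ≠ i} → L), inferInstance, Sigma.fst,
    fun x => F fun l => u fun i => x ⟨i, fun j => l j⟩,
    hF.comp fun l => hu.reindex fun i => (⟨i, fun j => l j⟩ : Σ i : ι, ({j // j ≠ i} → L)), ?_⟩
  rintro ⟨i, μ⟩ b c hc
  obtain ⟨g, hg, rfl⟩ := hgen _ c hc
  choose r hr hur using hg
  refine ⟨fun z => if h : i = z.1 then b else r (z.2 ⟨i, h⟩) z.1, by simp, ?_⟩
  rw [← hpow i]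
  refine congrArg F (funext fun l => ?_)
  rw [← hur]
  congr 1
  funext j
  dsimp only
  split_ifs with h
  · subst h
    exact (hr _).symm
  · rfl

theorem Attains.star (hI : Idempotent A) {ι κ : Type}
    {t : (κ → A.carrier) → A.carrier} {u : (ι → A.carrier) → A.carrier} (hu : TermOp A u)
    {j : κ} {i : ι} {b c d : A.carrier} (h₁ : Attains u i b d) (h₂ : Attains t j d c) :
    Attains (fun x => t fun j => u fun i => x (j, i)) (j, i) b c := by
  classical
  obtain ⟨y, rfl, rfl⟩ := h₁
  obtain ⟨z, hz, rfl⟩ := h₂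
  refine ⟨fun p => if p.1 = j then y p.2 else z p.1, by simp, ?_⟩
  simp only
  congr 1
  funext j'
  by_cases h : j' = j
  · subst h
    simp [hz]
  · simp [h, hu.idem hI]

theorem TermOp.attains_self (hI : Idempotent A) {ι : Type} {f : (ι → A.carrier) → A.carrier}
    (hf : TermOp A f) (i : ι) (b : A.carrier) : Attains f i b b :=
  ⟨fun _ => b, rfl, hf.idem hI b⟩

theorem reach_mono {T : A.carrier → A.carrier → Prop} (hT : ∀ b, T b b) (b : A.carrier) :
    Monotone (reach A T b) :=
  monotone_nat_of_le_succ fun _ c hc => subset_generated _ ⟨c, hc, hT c⟩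

/-- A subuniverse closed under one coordinate of a Taylor term is absorbing. -/
theorem IsTaylorTerm.absorbing {k : ℕ} {t : Term σ k} (ht : IsTaylorTerm A t) (j : Fin k)
    {C : Set A.carrier} (hC : Subuniverse A C)
    (hclosed : ∀ b ∈ C, ∀ c, Attains (t.eval A) j b c → c ∈ C) : Absorbing A C := by
  refine ⟨hC, 2, ?_⟩
  obtain ⟨u, v, hu, hv, huv⟩ := ht.2 j
  obtain ⟨p, hp⟩ := ((termOp_eval (A := A) t).reindex u).exists_term
  refine ⟨p, fun i a ha => ?_⟩
  rw [hp]
  by_cases h : i = 0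
  · subst h
    simp only [huv a]
    exact hclosed _ (ha 1 (by decide)) _ ⟨fun i => a (v i), by simp only [hv], rfl⟩
  · exact hclosed _ (ha 0 (Ne.symm h)) _ ⟨fun i => a (u i), by simp only [hu], rfl⟩

theorem exists_reach_eq_univ [Finite A.carrier] (hI : Idempotent A)
    (hno : ¬∃ B : Set A.carrier, ProperAbsorbing A B) {k : ℕ} {t : Term σ k}
    (ht : IsTaylorTerm A t) (j : Fin k) (b : A.carrier) :
    ∃ n, reach A (Attains (t.eval A) j) b n = Set.univ := by
  have hrefl := (termOp_eval (A := A) t).attains_self hI j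
  have hmono := reach_mono hrefl b
  obtain ⟨n, hn⟩ := WellFoundedGT.monotone_chain_condition ⟨_, hmono⟩
  replace hn : reach A (Attains (t.eval A) j) b n = reach A (Attains (t.eval A) j) b (n + 1) :=
    hn (n + 1) (Nat.le_succ n)
  refine ⟨n, by_contra fun hne => hno ⟨_, ht.absorbing j ?_ ?_, ?_, hne⟩⟩
  · rw [hn]
    exact subuniverse_generated _
  · intro d hd c hdc
    rw [hn]
    exact subset_generated _ ⟨d, hd, hdc⟩
  · exact ⟨b, hmono (Nat.zero_le n) rfl⟩

theorem exists_termOp_reach [Finite A.carrier] (hI : Idempotent A) {k : ℕ}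
    {t : (Fin k → A.carrier) → A.carrier} (ht : TermOp A t) (M : ℕ) :
    ∃ (ι : Type) (_ : Finite ι) (u : (ι → A.carrier) → A.carrier), TermOp A u ∧
      ∀ i, ∃ n : Fin k → ℕ, ∑ j, n j = M ∧
        ∀ j b, ∀ c ∈ reach A (Attains t j) b (n j), Attains u i b c := by
  induction M with
  | zero =>
    refine ⟨Unit, inferInstance, _, .var (), fun _ => ⟨0, by simp, ?_⟩⟩
    rintro j b c rfl
    exact ⟨fun _ => c, rfl, rfl⟩
  | succ M ih =>
    obtain ⟨ι, hι, u, hu, h⟩ := ih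
    obtain ⟨κ, hκ, π, w, hw, hsat⟩ :=
      exists_saturation hI (ht.comp fun j => hu.reindex (Prod.mk j))
    refine ⟨κ, hκ, w, hw, fun q => ?_⟩
    obtain ⟨n, hn, hreach⟩ := h (π q).2
    refine ⟨n + Pi.single (π q).1 1, by simp [Finset.sum_add_distrib, hn], ?_⟩
    intro j b c hc
    apply hsat
    by_cases hj : j = (π q).1
    · subst hj
      simp only [Pi.add_apply, Pi.single_eq_same] at hc
      refine generated_mono ?_ hc
      rintro c ⟨d, hd, hdc⟩
      exact (hreach _ b d hd).star hI hu hdc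
    · simp only [Pi.add_apply, Pi.single_eq_of_ne hj, add_zero] at hc
      exact subset_generated _ ((hreach j b c hc).star hI hu (ht.attains_self hI _ c))

end

/-- If `A` is a finite idempotent algebra with a Taylor term and
with no proper absorbing subalgebra, then there is a term operation `v` of `A`
such that for all `b c ∈ A` and every coordinate `i` of `v` there is a tuple with
`b` at coordinate `i` which `v` maps to `c`. -/
theorem bigterm {σ : Signature} (A : UAlgebra σ) [Fintype A.carrier]
    (hI : Idempotent A) (hT : ∃ (k : ℕ) (t : Term σ k), IsTaylorTerm A t)
    (hno : ¬∃ B : Set A.carrier, ProperAbsorbing A B) :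
    ∃ (n : ℕ) (v : Term σ n), ∀ (b c : A.carrier) (i : Fin n),
      ∃ a : Fin n → A.carrier, a i = b ∧ v.eval A a = c := by
  obtain ⟨k, t, ht⟩ := hT
  have htop := termOp_eval (A := A) t
  obtain rfl | hk := Nat.eq_zero_or_pos k
  · exact ⟨0, t, fun _ _ i => i.elim0⟩
  choose N hN using exists_reach_eq_univ hI hno ht
  obtain ⟨K, hK⟩ := (Set.finite_range fun p : Fin k × A.carrier => N p.1 p.2).bddAbove
  obtain ⟨ι, hι, u, hu, h⟩ := exists_termOp_reach hI htop (k * K)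
  obtain ⟨n, ⟨e⟩⟩ := Finite.exists_equiv_fin ι
  obtain ⟨v, hv⟩ := (hu.reindex e).exists_term
  refine ⟨n, v, fun b c i => ?_⟩
  obtain ⟨m, hm, hreach⟩ := h (e.symm i)
  obtain ⟨j, -, hj⟩ : ∃ j ∈ Finset.univ, K ≤ m j :=
    Finset.exists_le_of_sum_le ⟨⟨0, hk⟩, Finset.mem_univ _⟩ (by simp [hm])
  obtain ⟨x, hx, hux⟩ := hreach j b c <|
    reach_mono (htop.attains_self hI j) b ((hK ⟨(j, b), rfl⟩).trans hj) (by simp [hN])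
  exact ⟨fun l => x (e.symm l), hx, by simp [hv, hux]⟩
end

section
/- (Absorption Theorem) Let A and B be finite idempotent algebras in a Taylor variety and let R be a subdirect subalgebra of A × B that is linked and a proper subset of A × B. Then A or B has a proper absorbing subalgebra. -/
namespace Term

variable {σ : Signature}

/-- Simultaneous substitution of terms for the variables of a term. -/
def subst {n m : ℕ} : Term σ n → (Fin n → Term σ m) → Term σ m
  | .var i, g => g i
  | .app s ts, g => .app s fun j => subst (ts j) g

theorem eval_subst (A : UAlgebra σ) {n m : ℕ} (f : Term σ n) (g : Fin n → Term σ m)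
    (x : Fin m → A.carrier) : (f.subst g).eval A x = f.eval A fun i => (g i).eval A x := by
  induction f with
  | var i => rfl
  | app s ts ih => simp only [subst, eval, ih]

theorem eval_const {A : UAlgebra σ} (hA : Idempotent A) {n : ℕ} (f : Term σ n) (a : A.carrier) :
    f.eval A (fun _ => a) = a := by
  induction f with
  | var i => rfl
  | app s ts ih => simp only [eval, ih, hA s a]

/-- The star composition `f(g(x₀₀, x₀₁, …), g(x₁₀, x₁₁, …), …)`. -/
def star {n m : ℕ} (f : Term σ n) (g : Term σ m) : Term σ (n * m) :=
  f.subst fun i => g.subst fun j => .var (finProdFinEquiv (i, j))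

theorem eval_star (A : UAlgebra σ) {n m : ℕ} (f : Term σ n) (g : Term σ m)
    (x : Fin (n * m) → A.carrier) :
    (f.star g).eval A x = f.eval A fun i => g.eval A fun j => x (finProdFinEquiv (i, j)) := by
  simp only [star, eval_subst, eval]

/-- The values taken by `f` when its `i`-th argument is `b`. -/
def slice (A : UAlgebra σ) {n : ℕ} (f : Term σ n) (i : Fin n) (b : A.carrier) : Set A.carrier :=
  {c | ∃ x, x i = b ∧ f.eval A x = c}

theorem self_mem_slice {A : UAlgebra σ} (hA : Idempotent A) {n : ℕ} (f : Term σ n) (i : Fin n)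
    (b : A.carrier) : b ∈ f.slice A i b :=
  ⟨fun _ => b, rfl, eval_const hA f b⟩

theorem slice_subset_slice_star {A : UAlgebra σ} (hA : Idempotent A) {n m : ℕ} (f : Term σ n)
    (g : Term σ m) (i : Fin n) (j : Fin m) {b c : A.carrier} (hc : c ∈ g.slice A j b) :
    f.slice A i c ⊆ (f.star g).slice A (finProdFinEquiv (i, j)) b := by
  rintro _ ⟨x, hx, rfl⟩
  obtain ⟨y, hy, hyc⟩ := hc
  refine ⟨fun p => if (finProdFinEquiv.symm p).1 = i then y (finProdFinEquiv.symm p).2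
    else x (finProdFinEquiv.symm p).1, by simpa using hy, ?_⟩
  rw [eval_star]
  congr 1
  funext l
  by_cases h : l = i
  · subst h
    simpa [hx] using hyc
  · simpa [h] using eval_const hA g (x l)

/-- `g` dominates `f` if every slice of `g` contains the corresponding slice of `f` at some
coordinate. -/
def Dominated (A : UAlgebra σ) (f g : Σ n, Term σ n) : Prop :=
  ∀ j : Fin g.1, ∃ i : Fin f.1, ∀ b, f.2.slice A i b ⊆ g.2.slice A j b

instance (A : UAlgebra σ) : IsTrans (Σ n, Term σ n) (Dominated A) where
  trans f g h hfg hgh k := by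
    obtain ⟨j, hj⟩ := hgh k
    obtain ⟨i, hi⟩ := hfg j
    exact ⟨i, fun b => (hi b).trans (hj b)⟩

theorem directed_dominated {A : UAlgebra σ} (hA : Idempotent A) :
    Directed (Dominated A) (id : (Σ n, Term σ n) → Σ n, Term σ n) := by
  rintro ⟨n, f⟩ ⟨m, g⟩
  refine ⟨⟨n * m, f.star g⟩, fun p => ?_, fun p => ?_⟩ <;>
    obtain ⟨⟨i, j⟩, rfl⟩ := finProdFinEquiv.surjective p
  · exact ⟨i, fun b => slice_subset_slice_star hA f g i j (self_mem_slice hA g j b)⟩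
  · exact ⟨j, fun b c hc =>
      slice_subset_slice_star hA f g i j hc (self_mem_slice hA f i c)⟩

theorem exists_forall_dominated {A : UAlgebra σ} (hA : Idempotent A) {ι : Type*} [Finite ι]
    (F : ι → Σ n, Term σ n) : ∃ z, ∀ i, Dominated A (F i) z :=
  haveI : Nonempty (Σ n, Term σ n) := ⟨⟨1, .var 0⟩⟩
  (directed_dominated hA).finite_le F

/-- A term is transitive if fixing any single argument leaves every value attainable. -/
def IsTransitive (A : UAlgebra σ) {n : ℕ} (f : Term σ n) : Prop :=
  ∀ i b, f.slice A i b = Set.univ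

end Term

section Absorption

variable {σ : Signature} {A B : UAlgebra σ}

/-- A set which is an ideal of every term in some coordinate is absorbing in the presence of a
Taylor term. -/
theorem absorbing_of_projective {D : Set A.carrier}
    (hD : ∀ {n : ℕ} (f : Term σ n), ∃ l, ∀ x : Fin n → A.carrier, x l ∈ D → f.eval A x ∈ D)
    {k : ℕ} {t : Term σ k} (ht : IsTaylorTerm A t) : Absorbing A D := by
  refine ⟨fun s a ha => ?_, ?_⟩
  · obtain ⟨l, hl⟩ := hD (.app s .var)
    exact hl a (ha l)
  · obtain ⟨l, hl⟩ := hD t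
    obtain ⟨u, v, hu, hv, huv⟩ := ht.2 l
    refine ⟨2, t.subst fun i => .var (u i), fun j a ha => ?_⟩
    simp only [Term.eval_subst, Term.eval]
    by_cases hj : j = 0
    · rw [huv a]
      exact hl _ (by simpa [hv] using ha 1 (by simp [hj]))
    · exact hl _ (by simpa [hu] using ha 0 (Ne.symm hj))

theorem exists_slice_eq_univ [Finite A.carrier] (hA : Idempotent A) {k : ℕ} {t : Term σ k}
    (ht : IsTaylorTerm A t) (habs : ∀ C, ¬ ProperAbsorbing A C) (b : A.carrier) :
    ∃ f : Σ n, Term σ n, ∀ i, f.2.slice A i b = Set.univ := by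
  let 𝓕 : Set (Set A.carrier) := {D | ∀ f : Σ n, Term σ n, ∃ i, f.2.slice A i b ⊆ D}
  obtain ⟨z, hz⟩ : ∃ z : Σ n, Term σ n, ∀ i, z.2.slice A i b ∈ 𝓕 := by
    have hnot : ∀ D : {D // D ∉ 𝓕}, ∃ f : Σ n, Term σ n, ∀ i, ¬ f.2.slice A i b ⊆ D := by
      rintro ⟨D, hD⟩
      simpa [𝓕] using hD
    choose F hF using hnot
    obtain ⟨z, hz⟩ := Term.exists_forall_dominated hA F
    refine ⟨z, fun j => ?_⟩
    by_contra hj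
    obtain ⟨i, hi⟩ := hz ⟨_, hj⟩ j
    exact hF ⟨_, hj⟩ i (hi b)
  refine ⟨z, fun i => ?_⟩
  obtain ⟨D, hDi, hD⟩ := (Set.toFinite 𝓕).exists_le_minimal (hz i)
  suffices hDu : D = Set.univ from Set.univ_subset_iff.1 (hDu ▸ hDi)
  have hproj {n : ℕ} (f : Term σ n) :
      ∃ l, ∀ x : Fin n → A.carrier, x l ∈ D → f.eval A x ∈ D := by
    obtain ⟨p, hp⟩ := hD.prop ⟨_, f.star z.2⟩
    obtain ⟨⟨l, j⟩, rfl⟩ := finProdFinEquiv.surjective p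
    have hzD : D ⊆ z.2.slice A j b := hD.le_of_le (hz j) fun c hc =>
      hp (Term.slice_subset_slice_star hA f z.2 l j hc (Term.self_mem_slice hA f l c))
    exact ⟨l, fun x hx => hp (Term.slice_subset_slice_star hA f z.2 l j (hzD hx) ⟨x, rfl, rfl⟩)⟩
  by_contra hne
  obtain ⟨j, hj⟩ := hD.prop z
  exact habs D ⟨absorbing_of_projective hproj ht, ⟨b, hj (Term.self_mem_slice hA z.2 j b)⟩, hne⟩

theorem exists_isTransitive [Finite A.carrier] (hA : Idempotent A) {k : ℕ} {t : Term σ k}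
    (ht : IsTaylorTerm A t) (habs : ∀ C, ¬ ProperAbsorbing A C) :
    ∃ (n : ℕ) (f : Term σ n), f.IsTransitive A := by
  choose F hF using exists_slice_eq_univ hA ht habs
  obtain ⟨z, hz⟩ := Term.exists_forall_dominated hA F
  refine ⟨z.1, z.2, fun j b => ?_⟩
  obtain ⟨i, hi⟩ := hz b j
  exact Set.univ_subset_iff.1 (hF b i ▸ hi b)

/-- The relation `S` between `A` and `B` is preserved by all basic operations. -/
def Compatible (A B : UAlgebra σ) (S : A.carrier → B.carrier → Prop) : Prop :=
  ∀ s a b, (∀ i, S (a i) (b i)) → S (A.op s a) (B.op s b)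

variable {S : A.carrier → B.carrier → Prop}

theorem Compatible.eval (hS : Compatible A B S) {n : ℕ} (f : Term σ n) {a : Fin n → A.carrier}
    {b : Fin n → B.carrier} (h : ∀ i, S (a i) (b i)) : S (f.eval A a) (f.eval B b) := by
  induction f with
  | var i => exact h i
  | app s ts ih => exact hS s _ _ ih

theorem Compatible.flip (hS : Compatible A B S) : Compatible B A (flip S) :=
  fun s b a h => hS s a b h

theorem Compatible.comp {C : UAlgebra σ} {T : B.carrier → C.carrier → Prop}
    (hS : Compatible A B S) (hT : Compatible B C T) : Compatible A C (Relation.Comp S T) := by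
  intro s a c h
  choose b hab hbc using h
  exact ⟨B.op s b, hS s a b hab, hT s b c hbc⟩

/-- In an absorption-free algebra, the center of a relation to an algebra with a transitive term
is empty or everything. -/
theorem Compatible.eq_top_of_center (hS : Compatible A B S) (hB : Idempotent B)
    (hleft : ∀ a, ∃ b, S a b) {n : ℕ} {f : Term σ n} (hf : f.IsTransitive B)
    (habs : ∀ C, ¬ ProperAbsorbing A C) (hcen : ∃ a, ∀ b, S a b) (a : A.carrier)
    (b : B.carrier) : S a b := by
  by_contra hab
  refine habs {a | ∀ b, S a b} ⟨⟨fun s x hx c => ?_, n, f, fun k x hx c => ?_⟩, hcen,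
    fun h => hab ((h ▸ Set.mem_univ a : a ∈ {a | ∀ b, S a b}) b)⟩
  · rw [← hB s c]
    exact hS s x _ fun i => hx i c
  · obtain ⟨d, hd⟩ := hleft (x k)
    obtain ⟨y, hyk, rfl⟩ : c ∈ f.slice B k d := hf k d ▸ Set.mem_univ c
    refine hS.eval f fun i => ?_
    by_cases hi : i = k
    · subst hi
      rwa [hyk]
    · exact hx i hi (y i)

/-- A compatible relation between absorption-free algebras is full as soon as any two elements
on the left have a common neighbour. -/
theorem Compatible.eq_top_of_common_neighbour [Finite A.carrier] (hS : Compatible A B S)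
    (hA : Idempotent A) (hright : ∀ b, ∃ a, S a b)
    {n : ℕ} {f : Term σ n} (hf : f.IsTransitive A)
    (habsA : ∀ C, ¬ ProperAbsorbing A C) (habsB : ∀ C, ¬ ProperAbsorbing B C)
    (hcommon : ∀ x y, ∃ b, S x b ∧ S y b) (a : A.carrier) (b : B.carrier) : S a b := by
  classical
  have key (r : Finset A.carrier) : ∀ x y, ∃ b, S x b ∧ S y b ∧ ∀ z ∈ r, S z b := by
    induction r using Finset.induction_on with
    | empty => simpa using hcommon
    | insert e r _ ih =>
      let Q (x y : A.carrier) : Prop := ∃ b, S x b ∧ S y b ∧ ∀ z ∈ insert e r, S z b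
      have hQ : Compatible A A Q := by
        intro s x y h
        choose c hx hy hz using h
        exact ⟨B.op s c, hS s x c hx, hS s y c hy,
          fun z hzr => hA s z ▸ hS s _ c fun i => hz i z hzr⟩
      refine hQ.eq_top_of_center hA (fun x => ⟨x, ?_⟩) hf habsA ⟨e, fun y => ?_⟩
      · obtain ⟨c, hx, he, hr⟩ := ih x e
        exact ⟨c, hx, hx, by simpa [he] using hr⟩
      · obtain ⟨c, he, hy, hr⟩ := ih e y
        exact ⟨c, he, hy, by simpa [he] using hr⟩
  cases nonempty_fintype A.carrier
  obtain ⟨c, -, -, hc⟩ := key Finset.univ a a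
  exact hS.flip.eq_top_of_center hA hright hf habsB ⟨c, fun z => hc z (Finset.mem_univ z)⟩ b a

/-- On an absorption-free algebra the only compatible symmetric reflexive relation with full
transitive closure is the full one. -/
theorem Compatible.eq_top_of_reflTransGen [Finite A.carrier] {E : A.carrier → A.carrier → Prop}
    (hE : Compatible A A E) (hA : Idempotent A) {n : ℕ} {f : Term σ n} (hf : f.IsTransitive A)
    (habs : ∀ C, ¬ ProperAbsorbing A C) (hrefl : ∀ a, E a a) (hsymm : ∀ a b, E a b → E b a)
    (hgen : ∀ a b, Relation.ReflTransGen E a b) (a b : A.carrier) : E a b := by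
  by_contra hab
  let 𝓢 : Set (A.carrier → A.carrier → Prop) :=
    {S | Compatible A A S ∧ (∀ a b, S a b → S b a) ∧ E ≤ S ∧ ¬ ∀ a b, S a b}
  obtain ⟨S, -, hS⟩ := (Set.toFinite 𝓢).exists_le_maximal (a := E)
    ⟨hE, hsymm, le_rfl, fun h => hab (h a b)⟩
  obtain ⟨hSc, hSs, hES, hSne⟩ := hS.prop
  have hSr (a) : S a a := hES a a (hrefl a)
  by_cases hfull : ∀ a b, Relation.Comp S S a b
  · refine hSne (hSc.eq_top_of_common_neighbour hA (fun b => ⟨b, hSr b⟩) hf habs habs ?_)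
    intro x y
    obtain ⟨c, hxc, hcy⟩ := hfull x y
    exact ⟨c, hxc, hSs _ _ hcy⟩
  · have hle : S ≤ Relation.Comp S S := fun x y h => ⟨x, hSr x, h⟩
    have hcomp : Relation.Comp S S ≤ S := hS.le_of_ge
      ⟨hSc.comp hSc, fun x y ⟨c, hxc, hcy⟩ => ⟨c, hSs _ _ hcy, hSs _ _ hxc⟩, hES.trans hle, hfull⟩
      hle
    refine hSne fun x y => ?_
    induction hgen x y with
    | refl => exact hSr x
    | tail _ h ih => exact hcomp _ _ ⟨_, ih, hES _ _ h⟩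

end Absorption

/-- **Absorption Theorem.** Let `A`, `B` be finite idempotent
algebras in a Taylor variety (witnessed by a common Taylor term `t`) and let `R`
be a linked subdirect subuniverse of `A × B` which is a proper subset of `A × B`.
Then `A` or `B` has a proper absorbing subalgebra. -/
theorem absorption_theorem {σ : Signature} (A B : UAlgebra σ)
    [Fintype A.carrier] [Fintype B.carrier]
    (hIA : Idempotent A) (hIB : Idempotent B)
    {k : ℕ} (t : Term σ k) (hTA : IsTaylorTerm A t) (hTB : IsTaylorTerm B t)
    (R : Set (A.carrier × B.carrier)) (hR : Subuniverse (A.prod B) R)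
    (hsub : Subdirect2 R) (hlink : IsLinked R) (hprop : R ≠ Set.univ) :
    (∃ C : Set A.carrier, ProperAbsorbing A C) ∨
      (∃ C : Set B.carrier, ProperAbsorbing B C) := by
  by_contra! h
  obtain ⟨hAabs, hBabs⟩ := h
  obtain ⟨_, f, hf⟩ := exists_isTransitive hIA hTA hAabs
  let S (a : A.carrier) (b : B.carrier) : Prop := (a, b) ∈ R
  have hS : Compatible A B S := fun s a b h => hR s (fun i => (a i, b i)) h
  have hcommon : ∀ x y, Relation.Comp S (flip S) x y :=
    (hS.comp hS.flip).eq_top_of_reflTransGen hIA hf hAabs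
      (fun a => (hsub.1 a).imp fun _ hb => ⟨hb, hb⟩)
      (fun _ _ ⟨c, hac, hbc⟩ => ⟨c, hbc, hac⟩)
      (fun a b => hlink a b (hsub.1 a) (hsub.1 b))
  exact hprop (Set.eq_univ_of_forall fun p =>
    hS.eq_top_of_common_neighbour hIA hsub.2 hf hAabs hBabs hcommon p.1 p.2)
end

section
/- Let A be a finite algebra in a Taylor variety and G = (A, E) a smooth digraph of algebraic length one whose edge relation E is a subuniverse of A². Then G contains a loop, i.e., there is a ∈ A with (a,a) ∈ E. -/
/-- Connectivity via an oriented path pattern (`true` = forward edge). -/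
def ConnVia {α : Type} (E : α → α → Prop) : List Bool → α → α → Prop
  | [], a, b => a = b
  | d :: P, a, b => ∃ c, (if d then E a c else E c a) ∧ ConnVia E P c b

/-- Algebraic length of an oriented path pattern: forward minus backward edges. -/
def algLen (P : List Bool) : ℤ := (P.count true : ℤ) - (P.count false : ℤ)

/-- A digraph is smooth if every vertex has an outgoing and an incoming edge. -/
def IsSmooth {α : Type} (E : α → α → Prop) : Prop := ∀ a, (∃ b, E a b) ∧ (∃ b, E b a)

/-- Directed walks of length `k` from `a` to `b` staying inside `H`
(all vertices after the first are required to lie in `H`). -/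
def stepsIn {α : Type} (E : α → α → Prop) (H : Set α) : ℕ → α → α → Prop
  | 0, a, b => a = b
  | k + 1, a, b => ∃ c ∈ H, E a c ∧ stepsIn E H k c b

/-- The smooth part of the subdigraph induced on `B`: the largest `W ⊆ B` such
that every vertex of `W` has an out- and an in-neighbour inside `W`. -/
def SmoothPart {α : Type} (E : α → α → Prop) (B : Set α) : Set α :=
  ⋃₀ {W | W ⊆ B ∧ ∀ a ∈ W, (∃ b ∈ W, E a b) ∧ (∃ b ∈ W, E b a)}

namespace LoopLemma

open Function

variable {α : Type}

/-- A family of operations on `α`, indexed by their sets of variables, which contains the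
projections, is closed under composition and consists of idempotent operations. -/
structure IdemClone (α : Type) where
  mem : ∀ {ι : Type}, ((ι → α) → α) → Prop
  proj : ∀ {ι : Type} (i : ι), mem fun x => x i
  comp : ∀ {ι κ : Type} {f : (ι → α) → α} {g : ι → (κ → α) → α},
    mem f → (∀ i, mem (g i)) → mem fun x => f fun i => g i x
  idem : ∀ {ι : Type} {f : (ι → α) → α}, mem f → ∀ a, f (fun _ => a) = a

variable (C : IdemClone α)

/-- `X` is closed under the operations of the clone. -/
def Closed (X : Set α) : Prop :=
  ∀ {ι : Type} [Finite ι] {f : (ι → α) → α}, C.mem f → ∀ {x : ι → α}, (∀ i, x i ∈ X) → f x ∈ X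

/-- The binary relation `R` is preserved by the operations of the clone. -/
def Inv (R : α → α → Prop) : Prop :=
  ∀ {ι : Type} [Finite ι] {f : (ι → α) → α}, C.mem f →
    ∀ {x y : ι → α}, (∀ i, R (x i) (y i)) → R (f x) (f y)

/-- `Y ⊆ X` absorbs `X` by the operation `f`. -/
def AbsorbsBy {ι : Type} (f : (ι → α) → α) (Y X : Set α) : Prop :=
  ∀ (j : ι) (x : ι → α), x j ∈ X → (∀ i, i ≠ j → x i ∈ Y) → f x ∈ Y

/-- `Y` is an absorbing subuniverse of `X`. -/
def Absorbs (Y X : Set α) : Prop :=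
  Closed C Y ∧ Y ⊆ X ∧ ∃ (ι : Type) (_ : Finite ι) (f : (ι → α) → α), C.mem f ∧ AbsorbsBy f Y X

/-- `X` has no proper nonempty absorbing subuniverse. -/
def AbsFree (X : Set α) : Prop :=
  ∀ Y, Absorbs C Y X → Y.Nonempty → Y = X

/-- `t` satisfies a system of Taylor identities. -/
def Taylor {k : ℕ} (t : (Fin k → α) → α) : Prop :=
  ∀ j : Fin k, ∃ u v : Fin k → Fin 2, u j = 0 ∧ v j = 1 ∧
    ∀ x : Fin 2 → α, t (fun i => x (u i)) = t (fun i => x (v i))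

/-- `R` is linked as a bipartite graph between `X` and `Y`: predicates which are constant along
edges are constant on `X`. -/
def Linked (R : α → α → Prop) (X Y : Set α) : Prop :=
  ∀ P Q : α → Prop, (∀ x ∈ X, ∀ y ∈ Y, R x y → (P x ↔ Q y)) → ∀ x ∈ X, ∀ x' ∈ X, P x → P x'

/-- `R` is subdirect in `X × Y`. -/
def SubdirectOn (R : α → α → Prop) (X Y : Set α) : Prop :=
  (∀ x ∈ X, ∃ y ∈ Y, R x y) ∧ ∀ y ∈ Y, ∃ x ∈ X, R x y

variable {C}

theorem SubdirectOn.swap {R : α → α → Prop} {X Y : Set α} (h : SubdirectOn R X Y) :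
    SubdirectOn (flip R) Y X := ⟨h.2, h.1⟩

theorem Inv.swap {R : α → α → Prop} (h : Inv C R) : Inv C (flip R) :=
  fun hf _ _ hxy => h hf hxy

theorem Linked.swap {R : α → α → Prop} {X Y : Set α} (h : Linked R X Y)
    (hs : SubdirectOn R X Y) : Linked (flip R) Y X := by
  intro P Q hPQ y hy y' hy' hP
  obtain ⟨x, hx, hxy⟩ := hs.2 y hy
  obtain ⟨x', hx', hxy'⟩ := hs.2 y' hy'
  have := h Q P (fun a ha b hb hab => (hPQ b hb a ha hab).symm) x hx x' hx'
    ((hPQ y hy x hx hxy).1 hP)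
  exact (hPQ y' hy' x' hx' hxy').2 this

/-- Replacing the coordinates of a tuple one by one. -/
theorem hybrid {ι : Type} [Finite ι] (x x' : ι → α) (Φ : (ι → α) → Prop)
    (h : ∀ (w : ι → α) (j : ι), (∀ i, w i = x i ∨ w i = x' i) → w j = x j → Φ w →
      ∀ [DecidableEq ι], Φ (update w j (x' j))) (hx : Φ x) : Φ x' := by
  classical
  have := Fintype.ofFinite ι
  have key : ∀ K : Finset ι, Φ fun i => if i ∈ K then x' i else x i := by
    intro K
    induction K using Finset.induction_on with
    | empty => simpa using hx
    | insert j K hj ih =>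
      have := h _ j (fun i => by by_cases hi : i ∈ K <;> simp [hi]) (by simp [hj]) ih
      convert this using 1
      funext i
      by_cases hi : i = j
      · subst hi; simp
      · simp [hi]
  simpa using key Finset.univ

theorem Closed.image {R : α → α → Prop} {X Y : Set α} (hY : Closed C Y) (hX : Closed C X)
    (hR : Inv C R) : Closed C {y | y ∈ Y ∧ ∃ x ∈ X, R x y} := by
  intro ι _ f hf y hy
  choose h1 x hx hxy using hy
  exact ⟨hY hf h1, f x, hX hf hx, hR hf hxy⟩

/-- The image of an absorbing subuniverse absorbs the image. -/
theorem Absorbs.image {R : α → α → Prop} {X X' Y : Set α} (hY : Closed C Y)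
    (hR : Inv C R) (hX : ∀ y ∈ Y, ∃ x ∈ X, R x y) (h : Absorbs C X' X) :
    Absorbs C {y | y ∈ Y ∧ ∃ x ∈ X', R x y} Y := by
  obtain ⟨hX', hsub, ι, _, f, hf, hab⟩ := h
  refine ⟨hY.image hX' hR, fun y hy => hy.1, ι, ‹_›, f, hf, fun j y hyj hy => ?_⟩
  have hy' : ∀ i, ∃ x, y i ∈ Y ∧ R x (y i) ∧ x ∈ X ∧ (i ≠ j → x ∈ X') := by
    intro i
    by_cases hi : i = j
    · subst hi
      obtain ⟨x, hx, hxy⟩ := hX _ hyj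
      exact ⟨x, hyj, hxy, hx, fun h => absurd rfl h⟩
    · obtain ⟨h1, x, hx, hxy⟩ := hy i hi
      exact ⟨x, h1, hxy, hsub hx, fun _ => hx⟩
  choose x h1 h2 h3 h4 using hy'
  exact ⟨hY hf h1, f x, hab j x (h3 j) fun i hi => h4 i hi, hR hf h2⟩

theorem Absorbs.refl {X : Set α} (hX : Closed C X) : Absorbs C X X :=
  ⟨hX, subset_rfl, Unit, inferInstance, fun x => x (), C.proj (),
    fun _ _ hj _ => hj⟩

theorem Absorbs.trans {X Y Z : Set α} (h₁ : Absorbs C Z Y) (h₂ : Absorbs C Y X) :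
    Absorbs C Z X := by
  obtain ⟨hZ, hZY, ι, _, g, hg, hgab⟩ := h₁
  obtain ⟨-, hYX, κ, _, f, hf, hfab⟩ := h₂
  refine ⟨hZ, hZY.trans hYX, ι × κ, inferInstance, fun x => g fun i => f fun j => x (i, j),
    C.comp hg fun i => C.comp hf fun j => C.proj (i, j), ?_⟩
  rintro ⟨i, j⟩ x hxj hx
  refine hgab i _ (hfab j _ hxj fun j' hj' => hZY (hx _ ?_)) fun i' hi' =>
    hZ hf fun j' => hx _ ?_
  · intro h; exact hj' (congrArg Prod.snd h)
  · intro h; exact hi' (congrArg Prod.fst h)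

/-- If `R'` absorbs a linked relation `R`, then `R'` is linked. -/
theorem Linked.of_absorbs {R R' : α → α → Prop} {X Y X' Y' : Set α} (h : Linked R X Y)
    {ι : Type} [Finite ι] {f : (ι → α) → α} (hf : C.mem f) (hXX : X' ⊆ X)
    (htot : ∀ x ∈ X', ∃ y ∈ Y', R' x y)
    (hab : ∀ (j : ι) (u v : ι → α), u j ∈ X → v j ∈ Y → R (u j) (v j) →
      (∀ i, i ≠ j → u i ∈ X' ∧ v i ∈ Y' ∧ R' (u i) (v i)) →
      f u ∈ X' ∧ f v ∈ Y' ∧ R' (f u) (f v)) : Linked R' X' Y' := by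
  intro P Q hPQ x hx x' hx' hP
  have key : P (f fun _ => x') := by
    refine hybrid (fun _ => x) (fun _ => x') (fun w => P (f w)) ?_ (by rwa [C.idem hf])
    intro w j hw hwj hPw _
    have hwX : ∀ i, w i ∈ X' := fun i => by
      rcases hw i with h | h <;> simp only [h, hx, hx']
    choose w' hw' hww' using fun i => htot (w i) (hwX i)
    refine h (fun z => P (f (update w j z))) (fun z => Q (f (update w' j z))) ?_ x (hXX hx) x'
      (hXX hx') ?_
    · intro u hu v hv huv
      obtain ⟨h1, h2, h3⟩ := hab j (update w j u) (update w' j v) (by simpa) (by simpa)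
        (by simpa) (fun i hi => by simp [hi, hwX, hw', hww'])
      exact hPQ _ h1 _ h2 h3
    · have : update w j x = w := by rw [← hwj, update_eq_self]
      show P (f (update w j x))
      rwa [this]
  rwa [C.idem hf] at key

/-- The set of values of `f` on tuples from `X` whose `j`-th entry lies in `Y`. -/
def reach {ι : Type} (X : Set α) (f : (ι → α) → α) (j : ι) (Y : Set α) : Set α :=
  {c | ∃ x : ι → α, (∀ i, x i ∈ X) ∧ x j ∈ Y ∧ f x = c}

theorem subset_reach {ι : Type} {X Y : Set α} {f : (ι → α) → α} (hf : C.mem f) (j : ι)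
    (hYX : Y ⊆ X) : Y ⊆ reach X f j Y :=
  fun y hy => ⟨fun _ => y, fun _ => hYX hy, hy, C.idem hf y⟩

theorem reach_subset {ι : Type} [Finite ι] {X Y : Set α} {f : (ι → α) → α} (hX : Closed C X)
    (hf : C.mem f) (j : ι) : reach X f j Y ⊆ X := by
  rintro _ ⟨x, hx, -, rfl⟩
  exact hX hf hx

theorem reach_reach_subset {ι κ : Type} {X Y : Set α} {g : (ι → α) → α} {f : (κ → α) → α}
    (hf : C.mem f) (i : ι) (j : κ) :
    reach X g i (reach X f j Y) ⊆
      reach X (fun x : ι × κ → α => g fun i => f fun j => x (i, j)) (i, j) Y := by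
  classical
  rintro _ ⟨z, hz, ⟨w, hw, hwj, hwz⟩, rfl⟩
  refine ⟨fun p => if p.1 = i then w p.2 else z p.1, fun p => ?_, by simpa, ?_⟩
  · by_cases hp : p.1 = i <;> simp [hp, hw, hz]
  · show g _ = g z
    congr 1
    funext i'
    by_cases hi : i' = i
    · subst hi; simpa using hwz
    · simp [hi, C.idem hf]

/-- If every operation of the clone fixes `V` from some coordinate, then `V` is absorbing. -/
theorem absorbs_of_stuck {k : ℕ} {t : (Fin k → α) → α} (ht : C.mem t) (hT : Taylor t)
    {X V : Set α} (hVX : V ⊆ X)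
    (hV : ∀ {ι : Type} [Finite ι] {g : (ι → α) → α}, C.mem g → ∃ i, reach X g i V = V) :
    Absorbs C V X := by
  refine ⟨?_, hVX, ?_⟩
  · intro ι _ g hg x hx
    obtain ⟨i, hi⟩ := hV hg
    rw [← hi]
    exact ⟨x, fun i => hVX (hx i), hx i, rfl⟩
  · obtain ⟨j, hj⟩ := hV ht
    obtain ⟨u, v, hu, hv, huv⟩ := hT j
    have hclosed : ∀ (w : Fin k → Fin 2) (x : Fin 2 → α), (∀ i, x i ∈ X) → x (w j) ∈ V →
        t (fun i => x (w i)) ∈ V := by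
      intro w x hx hxj
      rw [← hj]
      exact ⟨_, fun i => hx (w i), hxj, rfl⟩
    refine ⟨Fin 2, inferInstance, fun x => t fun i => x (u i), C.comp ht fun i => C.proj (u i),
      fun l x hxl hx => ?_⟩
    have hxX : ∀ i, x i ∈ X := fun i => by
      by_cases h : i = l
      · rwa [h]
      · exact hVX (hx i h)
    by_cases hl : l = 0
    · show t (fun i => x (u i)) ∈ V
      rw [huv x]
      exact hclosed v x hxX (hv ▸ hx 1 (by simp [hl]))
    · exact hclosed u x hxX (hu ▸ hx 0 (Ne.symm hl))

/-- An absorption-free algebra with a Taylor term has a transitive term. -/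
theorem AbsFree.exists_transitive [Finite α] {k : ℕ} {t : (Fin k → α) → α} (ht : C.mem t)
    (hT : Taylor t) {X : Set α} (hX : Closed C X) (hfree : AbsFree C X) :
    ∃ (ι : Type) (_ : Finite ι) (f : (ι → α) → α), C.mem f ∧
      ∀ j, ∀ b ∈ X, ∀ c ∈ X, ∃ x : ι → α, (∀ i, x i ∈ X) ∧ x j = b ∧ f x = c := by
  classical
  have hone : ∀ V : Set α, ∃ (ι : Type) (_ : Finite ι) (g : (ι → α) → α), C.mem g ∧
      (V.Nonempty → V ⊆ X → V ≠ X → ∀ i, reach X g i V ≠ V) := by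
    intro V
    by_contra! hcon
    have hV := hcon Unit inferInstance (fun x => x ()) (C.proj ())
    refine hV.2.2.1 (hfree V (absorbs_of_stuck ht hT hV.2.1 fun {ι} _ {g} hg => ?_) hV.1)
    exact (hcon ι inferInstance g hg).2.2.2
  have hall : ∀ 𝒱 : Set (Set α), ∃ (ι : Type) (_ : Finite ι) (g : (ι → α) → α), C.mem g ∧
      ∀ V ∈ 𝒱, V.Nonempty → V ⊆ X → V ≠ X → ∀ i, reach X g i V ≠ V := by
    intro 𝒱
    induction 𝒱, 𝒱.toFinite using Set.Finite.induction_on with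
    | empty => exact ⟨Unit, inferInstance, fun x => x (), C.proj (), by simp⟩
    | insert _ _ ih =>
      rename_i V 𝒱 _ _
      obtain ⟨κ, _, f, hf, hfV⟩ := ih
      obtain ⟨ι, _, g, hg, hgV⟩ := hone V
      refine ⟨ι × κ, inferInstance, _, C.comp hg fun i => C.comp hf fun j => C.proj (i, j), ?_⟩
      rintro W hW hne hWX hWne ⟨i, j⟩ heq
      have h1 := reach_reach_subset (Y := W) (X := X) (g := g) hf i j
      rw [heq] at h1
      have h2 : W ⊆ reach X f j W := subset_reach hf j hWX
      have h3 := subset_reach (X := X) hg i (reach_subset (Y := W) hX hf j)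
      have h4 : reach X f j W = W := (h3.trans h1).antisymm h2
      rcases hW with rfl | hW
      · rw [h4] at h1 h3
        exact hgV hne hWX hWne i (h1.antisymm h3)
      · exact hfV W hW hne hWX hWne j h4
  obtain ⟨ι, _, g, hg, hgV⟩ := hall Set.univ
  have hgrow : ∀ n : ℕ, ∃ (κ : Type) (_ : Finite κ) (f : (κ → α) → α), C.mem f ∧
      ∀ j, ∀ b ∈ X, reach X f j {b} = X ∨ n ≤ (reach X f j {b}).ncard := by
    intro n
    induction n with
    | zero => exact ⟨Unit, inferInstance, fun x => x (), C.proj (), by simp⟩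
    | succ n ih =>
      obtain ⟨κ, _, f, hf, hfn⟩ := ih
      refine ⟨ι × κ, inferInstance, _, C.comp hg fun i => C.comp hf fun j => C.proj (i, j), ?_⟩
      rintro ⟨i, j⟩ b hb
      have hsub : reach X f j {b} ⊆ X := reach_subset hX hf j
      have h1 := reach_reach_subset (Y := {b}) (X := X) (g := g) hf i j
      have h2 := subset_reach (X := X) hg i hsub
      have h3 := reach_subset (Y := {b}) hX
        (C.comp hg fun i => C.comp hf fun j => C.proj (i, j)) (i, j)
      by_cases hfull : reach X f j {b} = X
      · left
        refine h3.antisymm ?_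
        rw [hfull] at h1 h2
        exact h2.trans h1
      · right
        have hn := (hfn j b hb).resolve_left hfull
        have hne : (reach X f j {b}).Nonempty :=
          ⟨b, subset_reach hf j (Set.singleton_subset_iff.2 hb) rfl⟩
        have hlt := Set.ncard_lt_ncard
          (h2.ssubset_of_ne (hgV _ trivial hne hsub hfull i).symm) (Set.toFinite _)
        exact (Nat.succ_le_of_lt (hn.trans_lt hlt)).trans
          (Set.ncard_le_ncard h1 (Set.toFinite _))
  obtain ⟨κ, _, f, hf, hfn⟩ := hgrow (X.ncard + 1)
  refine ⟨κ, ‹_›, f, hf, fun j b hb c hc => ?_⟩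
  have hfull : reach X f j {b} = X := (hfn j b hb).resolve_right fun h => by
    have := Set.ncard_le_ncard (reach_subset (Y := {b}) hX hf j) (Set.toFinite X)
    omega
  rw [← hfull] at hc
  exact hc

/-- A subdirect relation on absorption-free algebras in which any two elements on the left have
a common neighbour is full. -/
theorem full_of_common_neighbour [Finite α] {k : ℕ} {t : (Fin k → α) → α} (ht : C.mem t)
    (hT : Taylor t) {X Y : Set α} (hX : Closed C X) (hY : Closed C Y) (hXf : AbsFree C X)
    (hYf : AbsFree C Y) {R : α → α → Prop} (hR : Inv C R) (hs : SubdirectOn R X Y)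
    (hcom : ∀ x ∈ X, ∀ x' ∈ X, ∃ y ∈ Y, R x y ∧ R x' y) : ∀ x ∈ X, ∀ y ∈ Y, R x y := by
  classical
  intro x₀ hx₀ y₀ hy₀
  obtain ⟨ι, _, f, hf, htr⟩ := hXf.exists_transitive ht hT hX
  have hfin : ∀ (n : ℕ) (a : Fin n → α), (∀ i, a i ∈ X) → ∃ y ∈ Y, ∀ i, R (a i) y := by
    intro n
    induction n with
    | zero => exact fun a _ => ⟨y₀, hy₀, fun i => i.elim0⟩
    | succ n ih =>
      let Z : Set (Fin n → α) := {z | (∀ i, z i ∈ X) ∧ ∀ a ∈ X, ∃ y ∈ Y, R a y ∧ ∀ i, R (z i) y}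
      have hZop : ∀ {κ : Type} (g : (κ → α) → α) (w : κ → Fin n → α) (z : Fin n → α) (i : Fin n),
          C.mem g → update z i (g fun l => w l i) =
            fun i' => g fun l => update z i (w l i) i' := by
        intro κ g w z i hg
        funext i'
        by_cases h : i' = i
        · subst h; simp
        · simp [h, C.idem hg]
      have hupd : ∀ z ∈ Z, ∀ i, ∀ a ∈ X, update z i a ∈ Z := by
        intro z hz i a ha
        let V : Set α := {a | a ∈ X ∧ update z i a ∈ Z}
        suffices V = X from (this ▸ ha : a ∈ V).2
        refine hXf V ⟨?_, fun a ha => ha.1, ι, ‹_›, f, hf, ?_⟩ ⟨z i, hz.1 i, by simpa⟩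
        · intro κ _ g hg x hx
          refine ⟨hX hg fun l => (hx l).1, ?_⟩
          rw [hZop g (fun l _ => x l) z i hg]
          refine ⟨fun i' => hX hg fun l => (hx l).2.1 i', fun b hb => ?_⟩
          choose y hy hby hxy using fun l => (hx l).2.2 b hb
          refine ⟨g y, hY hg hy, ?_, fun i' => hR hg fun l => hxy l i'⟩
          have := hR hg (x := fun _ => b) hby
          rwa [C.idem hg] at this
        · intro j x hxj hx
          have hxX : ∀ l, x l ∈ X := fun l => by
            by_cases h : l = j
            · rwa [h]
            · exact (hx l h).1
          have hux : ∀ l i', update z i (x l) i' ∈ X := fun l i' => by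
            by_cases h : i' = i
            · subst h; simpa using hxX l
            · simpa [h] using hz.1 i'
          refine ⟨hX hf hxX, ?_⟩
          rw [hZop f (fun l _ => x l) z i hf]
          refine ⟨fun i' => hX hf fun l => hux l i', fun a ha => ?_⟩
          obtain ⟨y', hy', hxy'⟩ := ih _ (hux j)
          obtain ⟨b, hb, hby⟩ := hs.2 y' hy'
          obtain ⟨c, hc, hcj, rfl⟩ := htr j b hb a ha
          have : ∀ l, ∃ y ∈ Y, R (c l) y ∧ ∀ i', R (update z i (x l) i') y := by
            intro l
            by_cases h : l = j
            · subst h; exact ⟨y', hy', hcj ▸ hby, hxy'⟩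
            · exact (hx l h).2.2 (c l) (hc l)
          choose y hy hcy hxy using this
          exact ⟨f y, hY hf hy, hR hf hcy, fun i' => hR hf fun l => hxy l i'⟩
      intro a ha
      have hmem : (fun i => a (Fin.succ i)) ∈ Z := by
        refine hybrid (fun _ => a 0) (fun i => a (Fin.succ i)) (· ∈ Z) ?_ ?_
        · intro w j _ _ hw _
          convert hupd w hw j _ (ha j.succ)
        · refine ⟨fun _ => ha 0, fun b hb => ?_⟩
          obtain ⟨y, hy, h1, h2⟩ := hcom b hb _ (ha 0)
          exact ⟨y, hy, h1, fun _ => h2⟩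
      obtain ⟨y, hy, h1, h2⟩ := hmem.2 (a 0) (ha 0)
      exact ⟨y, hy, Fin.cases h1 h2⟩
  obtain ⟨n, ⟨e⟩⟩ := Finite.exists_equiv_fin α
  obtain ⟨y₁, hy₁, hall⟩ := hfin n (fun i => if e.symm i ∈ X then e.symm i else x₀)
    (fun i => by split_ifs <;> assumption)
  let V : Set α := {y | y ∈ Y ∧ ∀ x ∈ X, R x y}
  suffices V = Y from (this ▸ hy₀ : y₀ ∈ V).2 x₀ hx₀
  refine hYf V ⟨?_, fun y hy => hy.1, ι, ‹_›, f, hf, ?_⟩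
    ⟨y₁, hy₁, fun x hx => by simpa [hx] using hall (e x)⟩
  · intro κ _ g hg y hy
    refine ⟨hY hg fun l => (hy l).1, fun x hx => ?_⟩
    have := hR hg (x := fun _ => x) fun l => (hy l).2 x hx
    rwa [C.idem hg] at this
  · intro j y hyj hy
    refine ⟨hY hf fun l => ?_, fun x hx => ?_⟩
    · by_cases h : l = j
      · rwa [h]
      · exact (hy l h).1
    obtain ⟨b, hb, hby⟩ := hs.2 _ hyj
    obtain ⟨c, hc, hcj, rfl⟩ := htr j b hb x hx
    refine hR hf fun l => ?_
    by_cases h : l = j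
    · subst h; exact hcj ▸ hby
    · exact (hy l h).2 _ (hc l)

/-- A reflexive, symmetric and connected relation on an absorption-free algebra is full. -/
theorem full_of_connected [Finite α] {k : ℕ} {t : (Fin k → α) → α} (ht : C.mem t)
    (hT : Taylor t) {X : Set α} (hX : Closed C X) (hXf : AbsFree C X) {S : α → α → Prop}
    (hS : Inv C S) (hrefl : ∀ x ∈ X, S x x) (hsymm : ∀ x ∈ X, ∀ y ∈ X, S x y → S y x)
    (hconn : ∀ P : α → Prop, (∀ x ∈ X, ∀ y ∈ X, S x y → P x → P y) →
      ∀ x ∈ X, ∀ y ∈ X, P x → P y) : ∀ x ∈ X, ∀ y ∈ X, S x y := by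
  obtain ⟨n, hn⟩ : ∃ n, {p : α × α | p.1 ∈ X ∧ p.2 ∈ X ∧ ¬ S p.1 p.2}.ncard = n := ⟨_, rfl⟩
  induction n using Nat.strong_induction_on generalizing S with
  | _ n ih =>
    by_cases htrans : ∀ x ∈ X, ∀ y ∈ X, ∀ z ∈ X, S x y → S y z → S x z
    · exact fun x hx y hy => hconn (S x) (fun y hy z hz hyz hxy => htrans x hx y hy z hz hxy hyz)
        x hx y hy (hrefl x hx)
    push Not at htrans
    obtain ⟨x₁, hx₁, y₁, hy₁, z₁, hz₁, h1, h2, h3⟩ := htrans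
    have hcomp : ∀ x ∈ X, ∀ z ∈ X, ∃ y ∈ X, S x y ∧ S y z := by
      refine ih _ ?_ (S := fun x z => ∃ y ∈ X, S x y ∧ S y z) ?_ ?_ ?_ ?_ rfl
      · rw [← hn]
        refine Set.ncard_lt_ncard ⟨?_, fun hsub => ?_⟩ (Set.toFinite _)
        · rintro ⟨x, z⟩ ⟨hx, hz, h⟩
          exact ⟨hx, hz, fun hxz => h ⟨x, hx, hrefl x hx, hxz⟩⟩
        · exact (hsub (show (x₁, z₁) ∈ _ from ⟨hx₁, hz₁, h3⟩)).2.2 ⟨y₁, hy₁, h1, h2⟩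
      · intro ι _ f hf x z hxz
        choose y hy h1 h2 using hxz
        exact ⟨f y, hX hf hy, hS hf h1, hS hf h2⟩
      · exact fun x hx => ⟨x, hx, hrefl x hx, hrefl x hx⟩
      · rintro x hx z hz ⟨y, hy, hxy, hyz⟩
        exact ⟨y, hy, hsymm _ hy _ hz hyz, hsymm _ hx _ hy hxy⟩
      · intro P hP
        exact hconn P fun x hx y hy hxy => hP x hx y hy ⟨x, hx, hrefl x hx, hxy⟩
    refine full_of_common_neighbour ht hT hX hX hXf hXf hS
      ⟨fun x hx => ⟨x, hx, hrefl x hx⟩, fun x hx => ⟨x, hx, hrefl x hx⟩⟩ fun x hx z hz => ?_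
    obtain ⟨y, hy, hxy, hyz⟩ := hcomp x hx z hz
    exact ⟨y, hy, hxy, hsymm _ hy _ hz hyz⟩

/-- **Absorption theorem**: a linked subdirect relation on absorption-free algebras with a Taylor
term is full. -/
theorem Linked.full [Finite α] {k : ℕ} {t : (Fin k → α) → α} (ht : C.mem t)
    (hT : Taylor t) {X Y : Set α} (hX : Closed C X) (hY : Closed C Y) (hXf : AbsFree C X)
    (hYf : AbsFree C Y) {R : α → α → Prop} (hR : Inv C R) (hs : SubdirectOn R X Y)
    (hl : Linked R X Y) : ∀ x ∈ X, ∀ y ∈ Y, R x y := by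
  refine full_of_common_neighbour ht hT hX hY hXf hYf hR hs ?_
  refine full_of_connected ht hT hX hXf (S := fun x x' => ∃ y ∈ Y, R x y ∧ R x' y) ?_ ?_ ?_ ?_
  · intro ι _ f hf x z hxz
    choose y hy h1 h2 using hxz
    exact ⟨f y, hY hf hy, hR hf h1, hR hf h2⟩
  · intro x hx
    obtain ⟨y, hy, h⟩ := hs.1 x hx
    exact ⟨y, hy, h, h⟩
  · rintro x - z - ⟨y, hy, h1, h2⟩
    exact ⟨y, hy, h2, h1⟩
  · intro P hP
    refine hl P (fun y => ∃ x ∈ X, R x y ∧ P x) fun x hx y hy hxy => ⟨fun h => ⟨x, hx, hxy, h⟩, ?_⟩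
    rintro ⟨x', hx', hxy', h⟩
    exact hP x' hx' x hx ⟨y, hy, hxy', hxy⟩ h

/-- A proper absorbing subuniverse on the left of a linked relation can be chosen on one of the
two sides so that its neighbours cover the other side. -/
theorem Linked.exists_absorbs_covering [Finite α] {X Y : Set α} (hX : Closed C X)
    (hY : Closed C Y) {R : α → α → Prop} (hR : Inv C R) (hs : SubdirectOn R X Y)
    (hl : Linked R X Y) (hXf : ¬ AbsFree C X) :
    (∃ X', Absorbs C X' X ∧ X'.Nonempty ∧ X' ≠ X ∧ ∀ y ∈ Y, ∃ x ∈ X', R x y) ∨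
      ∃ Y', Absorbs C Y' Y ∧ Y'.Nonempty ∧ Y' ≠ Y ∧ ∀ x ∈ X, ∃ y ∈ Y', R x y := by
  have hfin : {Z | Absorbs C Z X ∧ Z.Nonempty ∧ Z ≠ X}.Finite := Set.toFinite _
  have hne : {Z | Absorbs C Z X ∧ Z.Nonempty ∧ Z ≠ X}.Nonempty := by
    unfold AbsFree at hXf
    push Not at hXf
    exact hXf
  obtain ⟨Z, ⟨hZ, hZne, hZX⟩, hmax⟩ := hfin.exists_maximal hne
  let W : Set α := {y | y ∈ Y ∧ ∃ x ∈ Z, R x y}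
  have hW : Absorbs C W Y := hZ.image hY hR hs.2
  by_cases hWY : W = Y
  · exact Or.inl ⟨Z, hZ, hZne, hZX, fun y hy => (hWY ▸ hy : y ∈ W).2⟩
  have hWne : W.Nonempty := by
    obtain ⟨x, hx⟩ := hZne
    obtain ⟨y, hy, hxy⟩ := hs.1 x (hZ.2.1 hx)
    exact ⟨y, hy, x, hx, hxy⟩
  refine Or.inr ⟨W, hW, hWne, hWY, ?_⟩
  let Z' : Set α := {x | x ∈ X ∧ ∃ y ∈ W, flip R y x}
  have hZ' : Absorbs C Z' X := hW.image hX hR.swap hs.1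
  have hZZ' : Z ⊆ Z' := fun x hx => by
    obtain ⟨y, hy, hxy⟩ := hs.1 x (hZ.2.1 hx)
    exact ⟨hZ.2.1 hx, y, ⟨hy, x, hx, hxy⟩, hxy⟩
  by_cases hfull : Z' = X
  · exact fun x hx => (hfull ▸ hx : x ∈ Z').2
  have hback : Z' ⊆ Z := hmax ⟨hZ', hZne.mono hZZ', hfull⟩ hZZ'
  refine absurd (hZ.2.1.antisymm fun x hx => ?_) hZX
  obtain ⟨z, hz⟩ := hZne
  refine hl (· ∈ Z) (· ∈ W) (fun x hx y hy hxy => ⟨fun h => ⟨hy, x, h, hxy⟩, fun h => ?_⟩) z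
    (hZ.2.1 hz) x hx hz
  exact hback ⟨hx, y, h, hxy⟩

/-- Shrinking the left side of a linked relation to an absorbing subuniverse whose neighbours cover
the right side. -/
theorem Linked.of_covering {X Y X' : Set α} (hY : Closed C Y) {R : α → α → Prop} (hR : Inv C R)
    (hs : SubdirectOn R X Y) (hl : Linked R X Y) (hX' : Absorbs C X' X) : Linked R X' Y := by
  obtain ⟨-, hsub, ι, _, f, hf, hab⟩ := hX'
  refine hl.of_absorbs hf hsub (fun x hx => hs.1 x (hsub hx)) fun j u v huj hvj hR' h => ?_
  refine ⟨hab j u huj fun i hi => (h i hi).1, hY hf fun i => ?_, hR hf fun i => ?_⟩ <;>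
  · by_cases hi : i = j
    · rwa [hi]
    · simp [h i hi]

/-- A linked subdirect relation contains the product of two nonempty absorbing subuniverses. -/
theorem Linked.exists_rectangle [Finite α] {k : ℕ} {t : (Fin k → α) → α} (ht : C.mem t)
    (hT : Taylor t) {X Y : Set α} (hX : Closed C X) (hY : Closed C Y) (hne : X.Nonempty)
    {R : α → α → Prop} (hR : Inv C R) (hs : SubdirectOn R X Y) (hl : Linked R X Y) :
    ∃ M N, Absorbs C M X ∧ Absorbs C N Y ∧ M.Nonempty ∧ N.Nonempty ∧
      ∀ x ∈ M, ∀ y ∈ N, R x y := by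
  obtain ⟨n, hn⟩ : ∃ n, X.ncard + Y.ncard = n := ⟨_, rfl⟩
  induction n using Nat.strong_induction_on generalizing X Y R with
  | _ n ih =>
    have hYne : Y.Nonempty := by
      obtain ⟨x, hx⟩ := hne
      obtain ⟨y, hy, -⟩ := hs.1 x hx
      exact ⟨y, hy⟩
    have left : ∀ X', Absorbs C X' X → X'.Nonempty → X' ≠ X → (∀ y ∈ Y, ∃ x ∈ X', R x y) →
        ∃ M N, Absorbs C M X ∧ Absorbs C N Y ∧ M.Nonempty ∧ N.Nonempty ∧
          ∀ x ∈ M, ∀ y ∈ N, R x y := by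
      intro X' hX' hX'ne hX'X hcov
      have hlt := Set.ncard_lt_ncard (hX'.2.1.ssubset_of_ne hX'X) (Set.toFinite X)
      obtain ⟨M, N, hM, hN, h⟩ := ih _ (by omega) hX'.1 hY hX'ne hR
        ⟨fun x hx => hs.1 x (hX'.2.1 hx), hcov⟩ (hl.of_covering hY hR hs hX') rfl
      exact ⟨M, N, hM.trans hX', hN, h⟩
    have right : ∀ Y', Absorbs C Y' Y → Y'.Nonempty → Y' ≠ Y → (∀ x ∈ X, ∃ y ∈ Y', R x y) →
        ∃ M N, Absorbs C M X ∧ Absorbs C N Y ∧ M.Nonempty ∧ N.Nonempty ∧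
          ∀ x ∈ M, ∀ y ∈ N, R x y := by
      intro Y' hY' hY'ne hY'Y hcov
      have hlt := Set.ncard_lt_ncard (hY'.2.1.ssubset_of_ne hY'Y) (Set.toFinite Y)
      obtain ⟨M, N, hM, hN, hMne, hNne, h⟩ := ih _ (by omega) hY'.1 hX hY'ne hR.swap
        ⟨fun y hy => hs.2 y (hY'.2.1 hy), hcov⟩
        ((hl.swap hs).of_covering hX hR.swap hs.swap hY') rfl
      exact ⟨N, M, hN, hM.trans hY', hNne, hMne, fun x hx y hy => h y hy x hx⟩
    by_cases hXf : AbsFree C X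
    · by_cases hYf : AbsFree C Y
      · exact ⟨X, Y, .refl hX, .refl hY, hne, hYne, hl.full ht hT hX hY hXf hYf hR hs⟩
      · rcases (hl.swap hs).exists_absorbs_covering hY hX hR.swap hs.swap hYf with h | h
        · obtain ⟨Y', h1, h2, h3, h4⟩ := h
          exact right Y' h1 h2 h3 h4
        · obtain ⟨X', h1, h2, h3, h4⟩ := h
          exact left X' h1 h2 h3 h4
    · rcases hl.exists_absorbs_covering hX hY hR hs hXf with h | h
      · obtain ⟨X', h1, h2, h3, h4⟩ := h
        exact left X' h1 h2 h3 h4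
      · obtain ⟨Y', h1, h2, h3, h4⟩ := h
        exact right Y' h1 h2 h3 h4

section Digraph

/-- Directed walks of a given length. -/
def relPow (E : α → α → Prop) : ℕ → α → α → Prop
  | 0, x, y => x = y
  | k + 1, x, z => ∃ y, E x y ∧ relPow E k y z

theorem relPow_add {E : α → α → Prop} {m n : ℕ} {x y z : α} (h₁ : relPow E m x y)
    (h₂ : relPow E n y z) : relPow E (m + n) x z := by
  induction m generalizing x with
  | zero => cases h₁; simpa using h₂
  | succ m ih =>
    obtain ⟨w, hxw, hwy⟩ := h₁
    rw [Nat.succ_add]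
    exact ⟨w, hxw, ih hwy⟩

theorem relPow_succ_right {E : α → α → Prop} {n : ℕ} {x z : α} :
    relPow E (n + 1) x z ↔ ∃ y, relPow E n x y ∧ E y z := by
  refine ⟨fun h => ?_, fun ⟨y, hxy, hyz⟩ => relPow_add hxy ⟨z, hyz, rfl⟩⟩
  induction n generalizing x with
  | zero =>
    obtain ⟨y, hxy, rfl⟩ := h
    exact ⟨x, rfl, hxy⟩
  | succ n ih =>
    obtain ⟨y, hxy, h⟩ := h
    obtain ⟨w, hyw, hwz⟩ := ih h
    exact ⟨w, ⟨y, hxy, hyw⟩, hwz⟩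

theorem relPow_flip {E : α → α → Prop} (n : ℕ) : relPow (flip E) n = flip (relPow E n) := by
  induction n with
  | zero => funext x y; exact propext eq_comm
  | succ n ih =>
    funext x y
    refine propext (Iff.trans ?_ relPow_succ_right.symm)
    simp only [relPow, ih, flip, and_comm]

theorem Inv.relPow {E : α → α → Prop} (hE : Inv C E) (n : ℕ) : Inv C (relPow E n) := by
  induction n with
  | zero =>
    intro ι _ f _ x y hxy
    exact congrArg f (funext hxy)
  | succ n ih =>
    intro ι _ f hf x y hxy
    choose z hxz hzy using hxy
    exact ⟨f z, hE hf hxz, ih hf hzy⟩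

/-- Every vertex of `X` has an in- and an out-neighbour in `X`. -/
def SmoothOn (E : α → α → Prop) (X : Set α) : Prop :=
  ∀ a ∈ X, (∃ b ∈ X, E a b) ∧ ∃ b ∈ X, E b a

/-- The subdigraph induced on `X`. -/
def induced (E : α → α → Prop) (X : Set α) (x y : α) : Prop :=
  x ∈ X ∧ y ∈ X ∧ E x y

theorem Inv.induced {E : α → α → Prop} {X : Set α} (hE : Inv C E) (hX : Closed C X) :
    Inv C (induced E X) :=
  fun hf _ _ h => ⟨hX hf fun i => (h i).1, hX hf fun i => (h i).2.1, hE hf fun i => (h i).2.2⟩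

theorem SmoothOn.induced {E : α → α → Prop} {X : Set α} (h : SmoothOn E X) :
    SmoothOn (induced E X) X := by
  intro a ha
  obtain ⟨⟨b, hb, hab⟩, c, hc, hca⟩ := h a ha
  exact ⟨⟨b, hb, ha, hb, hab⟩, c, hc, hc, ha, hca⟩

theorem SmoothOn.swap {E : α → α → Prop} {X : Set α} (h : SmoothOn E X) :
    SmoothOn (flip E) X := fun a ha => ⟨(h a ha).2, (h a ha).1⟩

theorem SmoothOn.subdirectOn_relPow {E : α → α → Prop} {X : Set α} (h : SmoothOn E X) (n : ℕ) :
    SubdirectOn (relPow E n) X X := by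
  induction n with
  | zero => exact ⟨fun x hx => ⟨x, hx, rfl⟩, fun x hx => ⟨x, hx, rfl⟩⟩
  | succ n ih =>
    refine ⟨fun x hx => ?_, fun z hz => ?_⟩
    · obtain ⟨y, hy, hxy⟩ := (h x hx).1
      obtain ⟨z, hz, hyz⟩ := ih.1 y hy
      exact ⟨z, hz, y, hxy, hyz⟩
    · obtain ⟨y, hy, hyz⟩ := ih.2 z hz
      obtain ⟨x, hx, hxy⟩ := (h y hy).2
      exact ⟨x, hx, y, hxy, hyz⟩

theorem smoothOn_smoothPart (E : α → α → Prop) (B : Set α) : SmoothOn E (SmoothPart E B) := by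
  rintro a ⟨W, hW, ha⟩
  obtain ⟨⟨b, hb, hab⟩, c, hc, hca⟩ := hW.2 a ha
  exact ⟨⟨b, ⟨W, hW, hb⟩, hab⟩, c, ⟨W, hW, hc⟩, hca⟩

theorem smoothPart_subset (E : α → α → Prop) (B : Set α) : SmoothPart E B ⊆ B :=
  Set.sUnion_subset fun _ hW => hW.1

theorem SmoothOn.subset_smoothPart {E : α → α → Prop} {B W : Set α} (h : SmoothOn E W)
    (hWB : W ⊆ B) : W ⊆ SmoothPart E B :=
  Set.subset_sUnion_of_mem ⟨hWB, h⟩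

theorem smoothPart_flip (E : α → α → Prop) (B : Set α) :
    SmoothPart (flip E) B = SmoothPart E B :=
  ((smoothOn_smoothPart (flip E) B).swap.subset_smoothPart (smoothPart_subset _ B)).antisymm
    ((smoothOn_smoothPart E B).swap.subset_smoothPart (smoothPart_subset _ B))

theorem smoothPart_nonempty [Finite α] {E : α → α → Prop} {B : Set α} (hne : B.Nonempty)
    (hpred : ∀ x ∈ B, ∃ y ∈ B, E y x) : (SmoothPart E B).Nonempty := by
  obtain ⟨W, ⟨hWB, hWne, hW⟩, hmin⟩ :=
    (Set.toFinite {W : Set α | W ⊆ B ∧ W.Nonempty ∧ ∀ x ∈ W, ∃ y ∈ W, E y x}).exists_minimal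
      ⟨B, subset_rfl, hne, hpred⟩
  have hsub : {x | x ∈ W ∧ ∃ y ∈ W, E x y} ⊆ W := fun x hx => hx.1
  have hle := hmin (y := {x | x ∈ W ∧ ∃ y ∈ W, E x y}) ⟨hsub.trans hWB, ?_, ?_⟩ hsub
  · refine hWne.mono (SmoothOn.subset_smoothPart (fun a ha => ⟨(hle ha).2, hW a ha⟩) hWB)
  · obtain ⟨x, hx⟩ := hWne
    obtain ⟨y, hy, hyx⟩ := hW x hx
    exact ⟨y, hy, x, hx, hyx⟩
  · rintro x ⟨hx, -⟩
    obtain ⟨y, hy, hyx⟩ := hW x hx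
    exact ⟨y, ⟨hy, x, hx, hyx⟩, hyx⟩

theorem Closed.smoothPart {E : α → α → Prop} (hE : Inv C E) {B : Set α} (hB : Closed C B) :
    Closed C (SmoothPart E B) := by
  intro ι _ f hf x hx
  let S := SmoothPart E B
  have hS : SmoothOn E S := smoothOn_smoothPart E B
  let W : Set α := {c | ∃ x : ι → α, (∀ i, x i ∈ S) ∧ f x = c}
  have hW : SmoothOn E W := by
    rintro _ ⟨x, hx, rfl⟩
    choose y hy hxy using fun i => (hS (x i) (hx i)).1
    choose z hz hzx using fun i => (hS (x i) (hx i)).2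
    exact ⟨⟨f y, ⟨y, hy, rfl⟩, hE hf hxy⟩, f z, ⟨z, hz, rfl⟩, hE hf hzx⟩
  refine hW.subset_smoothPart ?_ ⟨x, hx, rfl⟩
  rintro _ ⟨x, hx, rfl⟩
  exact hB hf fun i => smoothPart_subset E B (hx i)

theorem AbsorbsBy.smoothPart {E : α → α → Prop} (hE : Inv C E) {X B : Set α}
    (hX : SmoothOn E X) {ι : Type} [Finite ι] {f : (ι → α) → α} (hf : C.mem f)
    (h : AbsorbsBy f B X) : AbsorbsBy f (SmoothPart E B) X := by
  intro j x hxj hx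
  let S := SmoothPart E B
  have hS : SmoothOn E S := smoothOn_smoothPart E B
  let W : Set α := {c | ∃ x : ι → α, x j ∈ X ∧ (∀ i, i ≠ j → x i ∈ S) ∧ f x = c}
  have step : ∀ {D : α → α → Prop}, Inv C D → (∀ a ∈ X, ∃ b ∈ X, D a b) →
      (∀ a ∈ S, ∃ b ∈ S, D a b) → ∀ a ∈ W, ∃ b ∈ W, D a b := by
    rintro D hD hDX hDS _ ⟨x, hxj, hx, rfl⟩
    have : ∀ i, ∃ y, D (x i) y ∧ (i = j → y ∈ X) ∧ (i ≠ j → y ∈ S) := by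
      intro i
      by_cases hi : i = j
      · subst hi
        obtain ⟨b, hb, hab⟩ := hDX _ hxj
        exact ⟨b, hab, fun _ => hb, fun h => absurd rfl h⟩
      · obtain ⟨b, hb, hab⟩ := hDS _ (hx i hi)
        exact ⟨b, hab, fun h => absurd h hi, fun _ => hb⟩
    choose y hxy hyj hy using this
    exact ⟨f y, ⟨y, hyj j rfl, hy, rfl⟩, hD hf hxy⟩
  have hW : SmoothOn E W := fun a ha =>
    ⟨step hE (fun a ha => (hX a ha).1) (fun a ha => (hS a ha).1) a ha,
      step hE.swap (fun a ha => (hX a ha).2) (fun a ha => (hS a ha).2) a ha⟩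
  refine hW.subset_smoothPart ?_ ⟨x, hxj, hx, rfl⟩
  rintro _ ⟨x, hxj, hx, rfl⟩
  exact h j x hxj fun i hi => smoothPart_subset E B (hx i hi)

theorem relPow_mem {E : α → α → Prop} {X : Set α} (hEX : ∀ x y, E x y → x ∈ X ∧ y ∈ X) {n : ℕ}
    {x y : α} (hx : x ∈ X) (h : relPow E n x y) : y ∈ X := by
  induction n generalizing x with
  | zero => exact h ▸ hx
  | succ n ih =>
    obtain ⟨z, hxz, hzy⟩ := h
    exact ih (hEX _ _ hxz).2 hzy

theorem relPow_of_induced {E : α → α → Prop} {X : Set α} {n : ℕ} {x y : α}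
    (h : relPow (induced E X) n x y) : relPow E n x y := by
  induction n generalizing x with
  | zero => exact h
  | succ n ih =>
    obtain ⟨z, hxz, hzy⟩ := h
    exact ⟨z, hxz.2.2, ih hzy⟩

/-- `x` and `x'` are not separated by a predicate which is constant along the edges of `R`, viewed
as a bipartite graph between `X` and the whole type. -/
def LinkedIn (R : α → α → Prop) (X : Set α) (x x' : α) : Prop :=
  ∀ P Q : α → Prop, (∀ u ∈ X, ∀ v, R u v → (P u ↔ Q v)) → (P x ↔ P x')

theorem closed_linkedIn {R : α → α → Prop} {X : Set α} (hR : Inv C R) (hX : Closed C X)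
    (htot : ∀ x ∈ X, ∃ y, R x y) {a : α} (ha : a ∈ X) :
    Closed C {x | x ∈ X ∧ LinkedIn R X a x} := by
  intro ι _ f hf x hx
  refine ⟨hX hf fun i => (hx i).1, fun P Q hPQ => ?_⟩
  refine hybrid (fun _ => a) x (fun w => P a ↔ P (f w)) ?_ (by rw [C.idem hf])
  intro w j hw hwj h _
  have hwX : ∀ i, w i ∈ X := fun i => by
    rcases hw i with h | h <;> simp only [h, ha, (hx i).1]
  choose w' hw' using fun i => htot (w i) (hwX i)
  refine h.trans ?_
  have := (hx j).2 (fun z => P (f (update w j z))) (fun z => Q (f (update w' j z))) ?_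
  · have hw : update w j a = w := by rw [← hwj, update_eq_self]
    simpa only [hw] using this
  · intro u hu v huv
    refine hPQ _ (hX hf fun i => ?_) _ (hR hf fun i => ?_) <;>
    · by_cases hi : i = j
      · subst hi; simpa
      · simp [hi, hwX, hw']

theorem linked_linkedIn {R R' : α → α → Prop} {X : Set α} {a : α} {Y : Set α}
    (hY : ∀ x ∈ X, ∀ y, R x y → (LinkedIn R X a x ↔ y ∈ Y))
    (hR' : ∀ x ∈ X, ∀ y, LinkedIn R X a x → R x y → R' x y) :
    Linked R' {x | x ∈ X ∧ LinkedIn R X a x} Y := by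
  have key : ∀ P Q : α → Prop,
      (∀ x ∈ {x | x ∈ X ∧ LinkedIn R X a x}, ∀ y ∈ Y, R' x y → (P x ↔ Q y)) →
      ∀ x ∈ {x | x ∈ X ∧ LinkedIn R X a x}, (P a ↔ P x) := by
    intro P Q hPQ x hx
    have := hx.2 (fun z => LinkedIn R X a z ∧ (P a ↔ P z)) (fun y => y ∈ Y ∧ (P a ↔ Q y)) ?_
    · exact (this.1 ⟨fun _ _ _ => Iff.rfl, Iff.rfl⟩).2
    · intro u hu v huv
      have h1 := hY u hu v huv
      constructor
      · rintro ⟨h2, h3⟩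
        exact ⟨h1.1 h2, h3.trans (hPQ u ⟨hu, h2⟩ v (h1.1 h2) (hR' u hu v h2 huv))⟩
      · rintro ⟨h2, h3⟩
        exact ⟨h1.2 h2, h3.trans (hPQ u ⟨hu, h1.2 h2⟩ v h2 (hR' u hu v (h1.2 h2) huv)).symm⟩
  exact fun P Q hPQ x hx x' hx' h => (key P Q hPQ x' hx').1 ((key P Q hPQ x hx).2 h)

theorem LinkedIn.succ {E : α → α → Prop} {X : Set α} (hEX : ∀ x y, E x y → x ∈ X ∧ y ∈ X)
    (hs : SmoothOn E X) {n : ℕ} {x x' : α} (h : LinkedIn (relPow E n) X x x') :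
    LinkedIn (relPow E (n + 1)) X x x' := by
  intro P Q hPQ
  refine h P (fun v => ∃ w, E v w ∧ Q w) fun u hu v huv => ⟨fun hP => ?_, ?_⟩
  · obtain ⟨w, -, hvw⟩ := (hs v (relPow_mem hEX hu huv)).1
    exact ⟨w, hvw, (hPQ u hu w (relPow_succ_right.2 ⟨v, huv, hvw⟩)).1 hP⟩
  · rintro ⟨w, hvw, hQ⟩
    exact (hPQ u hu w (relPow_succ_right.2 ⟨v, huv, hvw⟩)).2 hQ

theorem LinkedIn.mono {E : α → α → Prop} {X : Set α} (hEX : ∀ x y, E x y → x ∈ X ∧ y ∈ X)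
    (hs : SmoothOn E X) {m n : ℕ} (hmn : m ≤ n) {x x' : α} (h : LinkedIn (relPow E m) X x x') :
    LinkedIn (relPow E n) X x x' := by
  induction n, hmn using Nat.le_induction with
  | base => exact h
  | succ n _ ih => exact ih.succ hEX hs

theorem LinkedIn.pred {E : α → α → Prop} {X : Set α} (hEX : ∀ x y, E x y → x ∈ X ∧ y ∈ X)
    (hs : SmoothOn E X) {n : ℕ} {x x' y y' : α} (hxy : E x y) (hxy' : E x' y')
    (h : LinkedIn (relPow E n) X y y') : LinkedIn (relPow E (n + 1)) X x x' := by
  intro P Q hPQ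
  have hP' : ∀ u ∈ X, ∀ v, relPow E n u v → ((∃ w, E w u ∧ P w) ↔ Q v) := by
    refine fun u hu v huv => ⟨?_, fun hQ => ?_⟩
    · rintro ⟨w, hwu, hP⟩
      exact (hPQ w (hEX _ _ hwu).1 v ⟨u, hwu, huv⟩).1 hP
    · obtain ⟨w, hw, hwu⟩ := (hs u hu).2
      exact ⟨w, hwu, (hPQ w hw v ⟨u, hwu, huv⟩).2 hQ⟩
  have hedge : ∀ {x y}, E x y → (P x ↔ ∃ w, E w y ∧ P w) := by
    intro x y hxy
    obtain ⟨v, -, hyv⟩ := (hs.subdirectOn_relPow n).1 y (hEX _ _ hxy).2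
    exact (hPQ x (hEX _ _ hxy).1 v ⟨y, hxy, hyv⟩).trans (hP' y (hEX _ _ hxy).2 v hyv).symm
  exact (hedge hxy).trans ((h _ Q hP').trans (hedge hxy').symm)

theorem relPow_induced_of_closed {E : α → α → Prop} {B : Set α}
    (hB : ∀ x ∈ B, ∀ y, E x y → y ∈ B) {n : ℕ} {x y : α} (hx : x ∈ B) (h : relPow E n x y) :
    relPow (induced E B) n x y := by
  induction n generalizing x with
  | zero => exact h
  | succ n ih =>
    obtain ⟨z, hxz, hzy⟩ := h
    exact ⟨z, ⟨hx, hB x hx z hxz, hxz⟩, ih (hB x hx z hxz) hzy⟩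

/-- In a smooth digraph, edges permute the classes of eventual linkedness. -/
theorem exists_perm_classes [Finite α] {E : α → α → Prop} {X : Set α}
    (hEX : ∀ x y, E x y → x ∈ X ∧ y ∈ X) (hs : SmoothOn E X) :
    ∃ (κ : Type) (c : X → κ) (σ : Equiv.Perm κ),
      (∀ x y, c x = c y ↔ ∃ n, LinkedIn (relPow E n) X x y) ∧
      ∀ x y : X, E x y → c x = σ (c y) := by
  let r : Setoid X :=
    { r := fun x y => ∃ n, LinkedIn (relPow E n) X x y
      iseqv := ⟨fun x => ⟨0, fun _ _ _ => Iff.rfl⟩,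
        fun ⟨n, h⟩ => ⟨n, fun P Q hPQ => (h P Q hPQ).symm⟩,
        fun ⟨m, h⟩ ⟨n, h'⟩ => ⟨max m n, fun P Q hPQ =>
          (h.mono hEX hs (le_max_left m n) P Q hPQ).trans
            (h'.mono hEX hs (le_max_right m n) P Q hPQ)⟩⟩ }
  have hpred : ∀ x x' y y' : X, E x y → E x' y' → r y y' → r x x' :=
    fun x x' y y' hxy hxy' ⟨n, h⟩ => ⟨n + 1, h.pred hEX hs hxy hxy'⟩
  choose p hpX hp using fun x : X => (hs x x.2).2
  let φ : Quotient r → Quotient r := Quotient.map (fun x : X => (⟨p x, hpX x⟩ : X))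
    fun y y' h => hpred _ _ _ _ (hp y) (hp y') h
  have hφ : ∀ x y : X, E x y → (⟦x⟧ : Quotient r) = φ ⟦y⟧ := fun x y hxy =>
    Quotient.sound (hpred _ _ _ _ hxy (hp y) (Setoid.refl y))
  have hsurj : Surjective φ := by
    intro q
    induction q using Quotient.inductionOn with
    | _ x =>
      obtain ⟨y, hy, hxy⟩ := (hs x x.2).1
      exact ⟨⟦⟨y, hy⟩⟧, (hφ x ⟨y, hy⟩ hxy).symm⟩
  exact ⟨Quotient r, fun x => ⟦x⟧,
    Equiv.ofBijective φ ⟨Finite.injective_iff_surjective.2 hsurj, hsurj⟩,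
    fun x y => Quotient.eq, hφ⟩

/-- A smooth digraph with a closed oriented walk of algebraic length one contains a component, some
power of which is linked. -/
theorem exists_linked_component [Finite α] {E : α → α → Prop} {X : Set α} (hX : Closed C X)
    (hE : Inv C E) (hEX : ∀ x y, E x y → x ∈ X ∧ y ∈ X) (hs : SmoothOn E X) {a : α} (ha : a ∈ X)
    {p : List Bool} (hp : ConnVia E p a a) (hlen : algLen p = 1) :
    ∃ B ⊆ X, B.Nonempty ∧ Closed C B ∧ SmoothOn E B ∧
      ∃ n, Linked (relPow (induced E B) n) B B := by
  obtain ⟨κ, c, σ, hc, hσ⟩ := exists_perm_classes hEX hs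
  have hwalk : ∀ (p : List Bool) (x : X) (y : α), ConnVia E p x y →
      ∃ hy : y ∈ X, c x = (σ ^ algLen p) (c ⟨y, hy⟩) := by
    intro p
    induction p with
    | nil =>
      rintro x y rfl
      exact ⟨x.2, by simp [algLen]⟩
    | cons d p ih =>
      rintro x y ⟨z, hxz, hzy⟩
      cases d with
      | true =>
        have hxz : E x z := by simpa using hxz
        obtain ⟨hy, h⟩ := ih ⟨z, (hEX _ _ hxz).2⟩ y hzy
        refine ⟨hy, ?_⟩
        have hl : algLen (true :: p) = 1 + algLen p := by simp [algLen]; ring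
        rw [hσ x ⟨z, (hEX _ _ hxz).2⟩ hxz, h, hl, zpow_add, zpow_one, Equiv.Perm.mul_apply]
      | false =>
        have hxz : E z x := by simpa using hxz
        obtain ⟨hy, h⟩ := ih ⟨z, (hEX _ _ hxz).1⟩ y hzy
        refine ⟨hy, ?_⟩
        have hl : algLen (false :: p) = -1 + algLen p := by simp [algLen]; ring
        rw [hl, zpow_add, Equiv.Perm.mul_apply, ← h, hσ ⟨z, (hEX _ _ hxz).1⟩ x hxz, zpow_neg_one,
          Equiv.Perm.inv_def, Equiv.symm_apply_apply]
  have hfix : c ⟨a, ha⟩ = σ (c ⟨a, ha⟩) := by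
    obtain ⟨_, h⟩ := hwalk p ⟨a, ha⟩ a hp
    rwa [hlen, zpow_one] at h
  obtain ⟨N, hN⟩ : ∃ N, ∀ x : X, c ⟨a, ha⟩ = c x ↔ LinkedIn (relPow E N) X a x := by
    have : ∀ x : X, ∃ n, c ⟨a, ha⟩ = c x → LinkedIn (relPow E n) X a x := by
      intro x
      by_cases h : c ⟨a, ha⟩ = c x
      · obtain ⟨n, hn⟩ := (hc _ _).1 h
        exact ⟨n, fun _ => hn⟩
      · exact ⟨0, fun h' => absurd h' h⟩
    choose n hn using this
    obtain ⟨N, hN⟩ := (Set.finite_range n).bddAbove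
    exact ⟨N, fun x => ⟨fun h => (hn x h).mono hEX hs (hN ⟨x, rfl⟩), fun h => (hc _ _).2 ⟨N, h⟩⟩⟩
  let B : Set α := {x | x ∈ X ∧ LinkedIn (relPow E N) X a x}
  have hBmem : ∀ x : X, (x : α) ∈ B ↔ c ⟨a, ha⟩ = c x := fun x =>
    ⟨fun h => (hN x).2 h.2, fun h => ⟨x.2, (hN x).1 h⟩⟩
  have hedge : ∀ x y, E x y → (x ∈ B ↔ y ∈ B) := by
    intro x y hxy
    have hx := (hEX _ _ hxy).1
    have hy := (hEX _ _ hxy).2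
    rw [hBmem ⟨x, hx⟩, hBmem ⟨y, hy⟩, hσ ⟨x, hx⟩ ⟨y, hy⟩ hxy]
    conv_lhs => rw [hfix]
    exact σ.apply_eq_iff_eq
  have hBout : ∀ x ∈ B, ∀ y, E x y → y ∈ B := fun x hx y hxy => (hedge x y hxy).1 hx
  have hBpow : ∀ n x y, relPow E n x y → (x ∈ B ↔ y ∈ B) := by
    intro n
    induction n with
    | zero => rintro x y rfl; rfl
    | succ n ih => rintro x y ⟨z, hxz, hzy⟩; exact (hedge x z hxz).trans (ih z y hzy)
  refine ⟨B, fun x hx => hx.1, ⟨a, ha, fun _ _ _ => Iff.rfl⟩,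
    closed_linkedIn (hE.relPow N) hX
      (fun x hx => (hs.subdirectOn_relPow N).1 x hx |>.imp fun _ h => h.2) ha, ?_, N, ?_⟩
  · intro x hx
    obtain ⟨⟨y, -, hxy⟩, z, -, hzx⟩ := hs x hx.1
    exact ⟨⟨y, hBout x hx y hxy, hxy⟩, z, (hedge z x hzx).2 hx, hzx⟩
  · refine linked_linkedIn (fun x hx y hxy => ?_) fun x hx y hax hxy =>
      relPow_induced_of_closed hBout ⟨hx, hax⟩ hxy
    rw [← hBpow N x y hxy]
    exact ⟨fun h => ⟨hx, h⟩, fun h => h.2⟩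

theorem exists_absorbs_covering_of_relPow {E : α → α → Prop} {X : Set α} (hX : Closed C X)
    (hE : Inv C E) (hEX : ∀ x y, E x y → x ∈ X ∧ y ∈ X) (hs : SmoothOn E X) {n : ℕ} {Z : Set α}
    (hZ : Absorbs C Z X) (hne : Z.Nonempty) (hZX : Z ≠ X)
    (hcov : ∀ y ∈ X, ∃ x ∈ Z, relPow E n x y) :
    ∃ Z', Absorbs C Z' X ∧ Z'.Nonempty ∧ Z' ≠ X ∧ ∀ y ∈ X, ∃ x ∈ Z', E x y := by
  induction n generalizing Z with
  | zero =>
    refine absurd (hZ.2.1.antisymm fun x hx => ?_) hZX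
    obtain ⟨_, hz, rfl⟩ := hcov x hx
    exact hz
  | succ n ih =>
    by_cases hfull : {y | y ∈ X ∧ ∃ x ∈ Z, E x y} = X
    · exact ⟨Z, hZ, hne, hZX, fun y hy => (hfull.ge hy).2⟩
    · refine ih (hZ.image hX hE fun x hx => (hs x hx).2) ?_ hfull fun y hy => ?_
      · obtain ⟨x, hx⟩ := hne
        obtain ⟨y, hy, hxy⟩ := (hs x (hZ.2.1 hx)).1
        exact ⟨y, hy, x, hx, hxy⟩
      · obtain ⟨x, hx, z, hxz, hzy⟩ := hcov y hy
        exact ⟨z, ⟨(hEX _ _ hxz).2, x, hx, hxz⟩, hzy⟩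

/-- If the algebra has a proper absorbing subuniverse, then some proper absorbing subuniverse
induces a smooth digraph. -/
theorem exists_absorbs_smoothOn [Finite α] {E : α → α → Prop} {X : Set α} (hX : Closed C X)
    (hE : Inv C E) (hEX : ∀ x y, E x y → x ∈ X ∧ y ∈ X) (hs : SmoothOn E X) {n : ℕ}
    (hl : Linked (relPow E n) X X) (hXf : ¬ AbsFree C X) :
    ∃ S, Absorbs C S X ∧ S.Nonempty ∧ S ≠ X ∧ SmoothOn E S := by
  have hcov : ∃ (D : α → α → Prop) (Z : Set α), (D = E ∨ D = flip E) ∧ Absorbs C Z X ∧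
      Z.Nonempty ∧ Z ≠ X ∧ ∀ y ∈ X, ∃ x ∈ Z, D x y := by
    rcases hl.exists_absorbs_covering hX hX (hE.relPow n) (hs.subdirectOn_relPow n) hXf with h | h
    · obtain ⟨Z, hZ, hne, hZX, h⟩ := h
      obtain ⟨Z', h'⟩ := exists_absorbs_covering_of_relPow hX hE hEX hs hZ hne hZX h
      exact ⟨E, Z', Or.inl rfl, h'⟩
    · obtain ⟨Z, hZ, hne, hZX, h⟩ := h
      obtain ⟨Z', h'⟩ := exists_absorbs_covering_of_relPow (n := n) hX hE.swap
        (fun x y hxy => (hEX y x hxy).symm) hs.swap hZ hne hZX (by rwa [relPow_flip])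
      exact ⟨flip E, Z', Or.inr rfl, h'⟩
  obtain ⟨D, Z, hD, hZ, hne, hZX, h⟩ := hcov
  have hDE : SmoothPart D Z = SmoothPart E Z := by
    rcases hD with rfl | rfl
    · rfl
    · exact smoothPart_flip E Z
  have hSne : (SmoothPart E Z).Nonempty :=
    hDE ▸ smoothPart_nonempty hne fun x hx => h x (hZ.2.1 hx)
  obtain ⟨hZc, hZsub, ι, _, f, hf, hab⟩ := hZ
  refine ⟨SmoothPart E Z, ⟨hZc.smoothPart hE, (smoothPart_subset E Z).trans hZsub, ι, ‹_›, f, hf,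
    hab.smoothPart hE hs hf⟩, hSne, fun heq => hZX ?_, smoothOn_smoothPart E Z⟩
  exact hZsub.antisymm (heq ▸ smoothPart_subset E Z)

theorem Linked.induced_of_absorbs {E : α → α → Prop} {X S : Set α} (hE : Inv C E)
    (hEX : ∀ x y, E x y → x ∈ X ∧ y ∈ X) (hS : Absorbs C S X) (hSs : SmoothOn E S) {n : ℕ}
    (hl : Linked (relPow E n) X X) : Linked (relPow (induced E S) n) S S := by
  obtain ⟨-, hsub, ι, _, f, hf, hab⟩ := hS
  have hpow : ∀ (n : ℕ) (j : ι) (u v : ι → α), u j ∈ X → relPow E n (u j) (v j) →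
      (∀ i, i ≠ j → u i ∈ S ∧ relPow (induced E S) n (u i) (v i)) →
      f u ∈ S ∧ relPow (induced E S) n (f u) (f v) := by
    intro n
    induction n with
    | zero =>
      intro j u v huj huv h
      refine ⟨hab j u huj fun i hi => (h i hi).1, congrArg f (funext fun i => ?_)⟩
      by_cases hi : i = j
      · exact hi ▸ huv
      · exact (h i hi).2
    | succ n ih =>
      intro j u v huj huv h
      have : ∀ i, ∃ w, E (u i) w ∧ relPow E n w (v i) ∧
          (i ≠ j → w ∈ S ∧ relPow (induced E S) n w (v i)) := by
        intro i
        by_cases hi : i = j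
        · subst hi
          obtain ⟨w, h1, h2⟩ := huv
          exact ⟨w, h1, h2, fun h => absurd rfl h⟩
        · obtain ⟨w, h1, h2⟩ := (h i hi).2
          exact ⟨w, h1.2.2, relPow_of_induced h2, fun _ => ⟨h1.2.1, h2⟩⟩
      choose w h1 h2 h3 using this
      have hfu : f u ∈ S := hab j u huj fun i hi => (h i hi).1
      obtain ⟨h4, h5⟩ := ih j w v (hEX _ _ (h1 j)).2 (h2 j) h3
      exact ⟨hfu, f w, ⟨hfu, h4, hE hf h1⟩, h5⟩
  refine hl.of_absorbs hf hsub (hSs.induced.subdirectOn_relPow n).1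
    fun j u v huj hvj huv h => ?_
  obtain ⟨h1, h2⟩ := hpow n j u v huj huv fun i hi => ⟨(h i hi).1, (h i hi).2.2⟩
  exact ⟨h1, relPow_mem (fun x y hxy => ⟨hxy.1, hxy.2.1⟩) h1 h2, h2⟩

theorem connVia_append {E : α → α → Prop} {p q : List Bool} {x y z : α} (h₁ : ConnVia E p x y)
    (h₂ : ConnVia E q y z) : ConnVia E (p ++ q) x z := by
  induction p generalizing x with
  | nil => cases h₁; exact h₂
  | cons d p ih =>
    obtain ⟨w, hxw, hwy⟩ := h₁
    exact ⟨w, hxw, ih hwy⟩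

theorem connVia_replicate_true {E : α → α → Prop} {n : ℕ} {x y : α} (h : relPow E n x y) :
    ConnVia E (List.replicate n true) x y := by
  induction n generalizing x with
  | zero => exact h
  | succ n ih =>
    obtain ⟨z, hxz, hzy⟩ := h
    exact ⟨z, by simpa using hxz, ih hzy⟩

theorem connVia_replicate_false {E : α → α → Prop} {n : ℕ} {x y : α} (h : relPow E n y x) :
    ConnVia E (List.replicate n false) x y := by
  induction n generalizing x with
  | zero => exact h.symm
  | succ n ih =>
    obtain ⟨z, hyz, hzx⟩ := relPow_succ_right.1 h
    exact ⟨z, by simpa using hzx, ih hyz⟩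

/-- If `n + 1` is the least exponent for which the power of `E` is linked and this power is full,
then a proper subuniverse induces a smooth digraph of algebraic length one. -/
theorem exists_smaller_of_full [Finite α] {k : ℕ} {t : (Fin k → α) → α} (ht : C.mem t)
    (hT : Taylor t) {E : α → α → Prop} {X : Set α} (hX : Closed C X) (hXf : AbsFree C X)
    (hE : Inv C E) (hEX : ∀ x y, E x y → x ∈ X ∧ y ∈ X) (hs : SmoothOn E X) {n : ℕ}
    (hnl : ¬ Linked (relPow E n) X X) (hfull : ∀ x ∈ X, ∀ y ∈ X, relPow E (n + 1) x y) :
    ∃ S ⊆ X, S ≠ X ∧ Closed C S ∧ SmoothOn E S ∧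
      ∃ a ∈ S, ∃ p, ConnVia (induced E S) p a a ∧ algLen p = 1 := by
  unfold Linked at hnl
  push Not at hnl
  obtain ⟨P, Q, hPQ, a, ha, a', ha', hPa, hPa'⟩ := hnl
  have htot := (hs.subdirectOn_relPow n).1
  let B : Set α := {x | x ∈ X ∧ LinkedIn (relPow E n) X a x}
  have hBX : B ⊆ X := fun x hx => hx.1
  have haB : a ∈ B := ⟨ha, fun _ _ _ => Iff.rfl⟩
  have haB' : a' ∉ B := fun h =>
    hPa' ((h.2 P Q fun u hu v huv => hPQ u hu v (relPow_mem hEX hu huv) huv).1 hPa)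
  have hB : Closed C B := closed_linkedIn (hE.relPow n) hX
    (fun x hx => (htot x hx).imp fun _ h => h.2) ha
  let D : Set α := {y | y ∈ X ∧ ∃ x ∈ B, relPow E n x y}
  have hD : Closed C D := hX.image hB (hE.relPow n)
  have hBD : ∀ x ∈ X, ∀ y, relPow E n x y → (LinkedIn (relPow E n) X a x ↔ y ∈ D) := by
    refine fun x hx y hxy => ⟨fun h => ⟨relPow_mem hEX hx hxy, x, ⟨hx, h⟩, hxy⟩, ?_⟩
    rintro ⟨-, x', hx', hxy'⟩ P Q hPQ
    exact (hx'.2 P Q hPQ).trans ((hPQ x' hx'.1 y hxy').trans (hPQ x hx y hxy).symm)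
  have hl : Linked (relPow E n) B D := linked_linkedIn hBD fun _ _ _ _ h => h
  have hsBD : SubdirectOn (relPow E n) B D := by
    refine ⟨fun x hx => ?_, fun y hy => hy.2⟩
    obtain ⟨y, -, hxy⟩ := htot x hx.1
    exact ⟨y, (hBD x hx.1 y hxy).1 hx.2, hxy⟩
  obtain ⟨M, N, hM, hN, hMne, hNne, hMN⟩ :=
    hl.exists_rectangle ht hT hB hD ⟨a, haB⟩ (hE.relPow n) hsBD
  have hMpred : ∀ x ∈ X, ∃ y ∈ M, flip E y x := by
    have habs := hM.image (R := flip E) hX hE.swap fun x hx => by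
      obtain ⟨y, hy, -⟩ := hsBD.1 a haB
      obtain ⟨z, hxz, hzy⟩ := hfull x hx y hy.1
      have hz := (hEX _ _ hxz).2
      exact ⟨z, ⟨hz, (hBD z hz y hzy).2 hy⟩, hxz⟩
    have := hXf _ habs <| by
      obtain ⟨y, hy⟩ := hMne
      obtain ⟨x, hx, hxy⟩ := (hs y (hM.2.1 hy).1).2
      exact ⟨x, hx, y, hy, hxy⟩
    exact fun x hx => (this.ge hx).2
  have hNsucc : ∀ y ∈ X, ∃ x ∈ N, E x y := by
    have habs := hN.image hX hE fun y hy => by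
      obtain ⟨z, haz, hzy⟩ := relPow_succ_right.1 (hfull a ha y hy)
      exact ⟨z, (hBD a ha z haz).1 haB.2, hzy⟩
    have := hXf _ habs <| by
      obtain ⟨x, hx⟩ := hNne
      obtain ⟨y, hy, hxy⟩ := (hs x (hN.2.1 hx).1).1
      exact ⟨y, hy, x, hx, hxy⟩
    exact fun y hy => (this.ge hy).2
  let S := SmoothPart E B
  have hS : SmoothOn E S := smoothOn_smoothPart E B
  have hSB : S ⊆ B := smoothPart_subset E B
  have hSD : S ⊆ D := by
    intro y hy
    obtain ⟨x, hx, hxy⟩ := (hS.subdirectOn_relPow n).2 y hy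
    exact (hBD x (hSB hx).1 y hxy).1 (hSB hx).2
  have hMS : SmoothPart E M ⊆ S :=
    (smoothOn_smoothPart E M).subset_smoothPart ((smoothPart_subset E M).trans hM.2.1)
  have hNS : SmoothPart E N ⊆ S := by
    refine (smoothOn_smoothPart E N).subset_smoothPart fun x hx => ?_
    obtain ⟨y, hy, hxy⟩ := ((smoothOn_smoothPart E N).subdirectOn_relPow n).1 x hx
    have hxX := (hN.2.1 (smoothPart_subset E N hx)).1
    exact ⟨hxX, (hBD x hxX y hxy).2 (hN.2.1 (smoothPart_subset E N hy))⟩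
  have hmid : ∀ p ∈ S, ∀ q ∈ S, ∀ i j x, i + j = n → relPow E i p x → relPow E j x q → x ∈ S := by
    intro p hp q hq i j x hij hpx hxq
    let W : Set α := {x | x ∈ S ∨ ∃ i j, i + j = n ∧ relPow E i p x ∧ relPow E j x q}
    have hW : SmoothOn E W := by
      rintro x (hx | ⟨i, j, hij, hpx, hxq⟩)
      · obtain ⟨⟨y, hy, hxy⟩, z, hz, hzx⟩ := hS x hx
        exact ⟨⟨y, Or.inl hy, hxy⟩, z, Or.inl hz, hzx⟩
      · constructor
        · cases j with
          | zero =>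
            obtain ⟨y, hy, hqy⟩ := (hS q hq).1
            exact ⟨y, Or.inl hy, hxq ▸ hqy⟩
          | succ j =>
            obtain ⟨y, hxy, hyq⟩ := hxq
            exact ⟨y, Or.inr ⟨i + 1, j, by omega, relPow_succ_right.2 ⟨x, hpx, hxy⟩, hyq⟩, hxy⟩
        · cases i with
          | zero =>
            obtain ⟨y, hy, hyp⟩ := (hS p hp).2
            exact ⟨y, Or.inl hy, hpx ▸ hyp⟩
          | succ i =>
            obtain ⟨y, hpy, hyx⟩ := relPow_succ_right.1 hpx
            exact ⟨y, Or.inr ⟨i, j + 1, by omega, hpy, x, hyx, hxq⟩, hyx⟩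
    refine hW.subset_smoothPart ?_ (Or.inr ⟨i, j, hij, hpx, hxq⟩)
    rintro x (hx | ⟨i, j, hij, hpx, hxq⟩)
    · exact hSB hx
    · have hxX := relPow_mem hEX (hSB hp).1 hpx
      obtain ⟨y, hy, hqy⟩ := (hS.subdirectOn_relPow i).1 q hq
      have hxy := relPow_add hxq hqy
      rw [Nat.add_comm, hij] at hxy
      exact ⟨hxX, (hBD x hxX y hxy).2 (hSD hy)⟩
  have hwalk : ∀ p ∈ S, ∀ q ∈ S, relPow E n p q → relPow (induced E S) n p q := by
    intro p hp q hq hpq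
    have : ∀ j i x, i + j = n → relPow E i p x → relPow E j x q → relPow (induced E S) j x q := by
      intro j
      induction j with
      | zero => exact fun _ _ _ _ h => h
      | succ j ih =>
        rintro i x hij hpx ⟨y, hxy, hyq⟩
        have hpy : relPow E (i + 1) p y := relPow_succ_right.2 ⟨x, hpx, hxy⟩
        exact ⟨y, ⟨hmid p hp q hq i (j + 1) x hij hpx ⟨y, hxy, hyq⟩,
          hmid p hp q hq (i + 1) j y (by omega) hpy hyq, hxy⟩, ih (i + 1) y (by omega) hpy hyq⟩
    exact this n 0 p (by omega) rfl hpq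
  obtain ⟨x, hx⟩ : (SmoothPart E M).Nonempty := smoothPart_flip E M ▸
    smoothPart_nonempty hMne fun x hx => hMpred x (hM.2.1 hx).1
  obtain ⟨y, hy, hxy⟩ := (smoothOn_smoothPart E M x hx).1
  obtain ⟨z, hz⟩ : (SmoothPart E N).Nonempty :=
    smoothPart_nonempty hNne fun x hx => hNsucc x (hN.2.1 hx).1
  have hrect : ∀ w ∈ SmoothPart E M, relPow (induced E S) n w z := fun w hw =>
    hwalk w (hMS hw) z (hNS hz) (hMN w (smoothPart_subset E M hw) z (smoothPart_subset E N hz))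
  refine ⟨S, hSB.trans hBX, fun h => haB' (hSB (h ▸ ha')), hB.smoothPart hE, hS, x, hMS hx,
    true :: (List.replicate n true ++ List.replicate n false), ⟨y, ?_, ?_⟩, ?_⟩
  · simpa using ⟨hMS hx, hMS hy, hxy⟩
  · exact connVia_append (connVia_replicate_true (hrect y hy)) (connVia_replicate_false (hrect x hx))
  · simp [algLen, List.count_replicate]

/-- The loop lemma for smooth digraphs, some power of which is linked. -/
theorem exists_loop_of_linked [Finite α] {k : ℕ} {t : (Fin k → α) → α} (ht : C.mem t)
    (hT : Taylor t) {E : α → α → Prop} {X : Set α} (hX : Closed C X) (hne : X.Nonempty)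
    (hE : Inv C E) (hEX : ∀ x y, E x y → x ∈ X ∧ y ∈ X) (hs : SmoothOn E X)
    (hl : ∃ n, Linked (relPow E n) X X) : ∃ a, E a a := by
  classical
  obtain ⟨m, hm⟩ : ∃ m, X.ncard = m := ⟨_, rfl⟩
  induction m using Nat.strong_induction_on generalizing X E with
  | _ m ih =>
    have reduce : ∀ S ⊆ X, S ≠ X → S.Nonempty → Closed C S → SmoothOn E S →
        (∃ n, Linked (relPow (induced E S) n) S S) → ∃ a, E a a := by
      intro S hSX hne hSne hS hSs hSl
      obtain ⟨a, ha⟩ := ih _ (hm ▸ Set.ncard_lt_ncard (hSX.ssubset_of_ne hne) (Set.toFinite X)) hS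
        hSne (hE.induced hS) (fun x y h => ⟨h.1, h.2.1⟩) hSs.induced hSl rfl
      exact ⟨a, ha.2.2⟩
    by_cases hXf : AbsFree C X
    · cases hn : Nat.find hl with
      | zero =>
        have h0 : Linked (relPow E 0) X X := hn ▸ Nat.find_spec hl
        obtain ⟨x, hx⟩ := hne
        obtain ⟨y, hy, hxy⟩ := (hs x hx).1
        have : x = y := h0 (x = ·) (x = ·) (fun u _ v _ huv => by rw [show u = v from huv])
          x hx y hy rfl
        exact ⟨x, this ▸ hxy⟩
      | succ n =>
        have h1 : Linked (relPow E (n + 1)) X X := hn ▸ Nat.find_spec hl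
        have h2 : ¬ Linked (relPow E n) X X := Nat.find_min hl (by omega)
        obtain ⟨S, hSX, hne, hS, hSs, a, ha, p, hp, hlen⟩ :=
          exists_smaller_of_full ht hT hX hXf hE hEX hs h2
            (h1.full ht hT hX hX hXf hXf (hE.relPow _) (hs.subdirectOn_relPow _))
        obtain ⟨B, hBS, hBne, hB, hBs, hBl⟩ := exists_linked_component hS (hE.induced hS)
          (fun x y h => ⟨h.1, h.2.1⟩) hSs.induced ha hp hlen
        have hind : induced (induced E S) B = induced E B := by
          funext x y
          exact propext ⟨fun h => ⟨h.1, h.2.1, h.2.2.2.2⟩,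
            fun h => ⟨h.1, h.2.1, hBS h.1, hBS h.2.1, h.2.2⟩⟩
        refine reduce B (hBS.trans hSX) (fun h => hne ?_) hBne hB (fun x hx => ?_) (hind ▸ hBl)
        · exact hSX.antisymm (h ▸ hBS)
        · obtain ⟨⟨y, hy, hxy⟩, z, hz, hzx⟩ := hBs x hx
          exact ⟨⟨y, hy, hxy.2.2⟩, z, hz, hzx.2.2⟩
    · obtain ⟨n, hn⟩ := hl
      obtain ⟨S, hS, hSne, hSX, hSs⟩ := exists_absorbs_smoothOn hX hE hEX hs hn hXf
      exact reduce S hS.2.1 hSX hSne hS.1 hSs ⟨n, hn.induced_of_absorbs hE hEX hS hSs⟩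

end Digraph

section TermOperations

variable {σ : Signature} (A : UAlgebra σ)

/-- Operations obtained from projections by the basic operations of an algebra. -/
inductive TermOp (ι : Type) : ((ι → A.carrier) → A.carrier) → Prop
  | var (i : ι) : TermOp ι fun x => x i
  | app (s : σ.symbols) (g : Fin (σ.arity s) → (ι → A.carrier) → A.carrier) :
      (∀ j, TermOp ι (g j)) → TermOp ι fun x => A.op s fun j => g j x

/-- The clone of term operations of an idempotent algebra. -/
def termClone (hI : Idempotent A) : IdemClone A.carrier where
  mem := fun {ι} f => TermOp A ι f
  proj := TermOp.var
  comp := by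
    intro ι κ f g hf hg
    induction hf with
    | var i => exact hg i
    | app s h _ ih => exact TermOp.app s (fun j x => h j fun i => g i x) ih
  idem := by
    intro ι f hf a
    induction hf with
    | var i => rfl
    | app s h _ ih => simp only [ih, hI s a]

variable {A}

theorem termOp_eval {n : ℕ} (t : Term σ n) : TermOp A (Fin n) (t.eval A) := by
  induction t with
  | var i => exact TermOp.var i
  | app s ts ih => exact TermOp.app s (fun j => (ts j).eval A) ih

theorem inv_termClone (hI : Idempotent A) {E : A.carrier → A.carrier → Prop}
    (hE : ∀ (s : σ.symbols) (a b : Fin (σ.arity s) → A.carrier),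
      (∀ i, E (a i) (b i)) → E (A.op s a) (A.op s b)) : Inv (termClone A hI) E := by
  intro ι _ f hf x y hxy
  have hf' : TermOp A ι f := hf
  clear hf
  induction hf' with
  | var i => exact hxy i
  | app s g _ ih => exact hE s _ _ ih

end TermOperations

end LoopLemma

/-- Let `A` be a finite algebra in a Taylor variety and
`G = (A, E)` a smooth digraph of algebraic length one whose edge relation is a
subuniverse of `A²`. Then `G` contains a loop. -/
theorem loop_theorem {σ : Signature} (A : UAlgebra σ) [Fintype A.carrier]
    (hI : Idempotent A) (hT : ∃ (k : ℕ) (t : Term σ k), IsTaylorTerm A t)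
    (E : A.carrier → A.carrier → Prop)
    (hpres : ∀ (s : σ.symbols) (a b : Fin (σ.arity s) → A.carrier),
      (∀ i, E (a i) (b i)) → E (A.op s a) (A.op s b))
    (hsmooth : IsSmooth E)
    (hal : ∃ (a : A.carrier) (P : List Bool), ConnVia E P a a ∧ algLen P = 1) :
    ∃ a : A.carrier, E a a := by
  obtain ⟨k, t, -, hT⟩ := hT
  obtain ⟨a, p, hp, hlen⟩ := hal
  have hE : LoopLemma.Inv (LoopLemma.termClone A hI) E := LoopLemma.inv_termClone hI hpres
  have huniv : LoopLemma.Closed (LoopLemma.termClone A hI) Set.univ := by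
    intro ι _ f _ x _
    trivial
  have ht : (LoopLemma.termClone A hI).mem (t.eval A) := LoopLemma.termOp_eval t
  have hs : LoopLemma.SmoothOn E Set.univ := fun x _ => by simpa using hsmooth x
  obtain ⟨B, -, hBne, hB, hBs, hBl⟩ := LoopLemma.exists_linked_component huniv hE
    (fun _ _ _ => ⟨trivial, trivial⟩) hs (Set.mem_univ a) hp hlen
  obtain ⟨b, hb⟩ := LoopLemma.exists_loop_of_linked ht hT hB hBne (hE.induced hB)
    (fun _ _ h => ⟨h.1, h.2.1⟩) hBs.induced hBl
  exact ⟨b, hb.2.2⟩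
end
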